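/- arXiv:2103.09227 — 6 statements merged into one kernel-verified Lean document; each statement's English description precedes it below -/
import Mathlib

section
/- Let Ω ⊆ ℂⁿ be a bounded domain, let ξ ∈ ∂Ω, and let B_ξ be an open ball centred at ξ that admits a C¹ defining function for ∂Ω. Assume: (i) for every q ∈ ∂Ω ∩ B_ξ, T̃_q(∂Ω) ∩ cl(Ω) ∩ B_ξ = {q} (i.e., ∂Ω ∩ B_ξ is a C¹-smooth strictly convex hypersurface); and (ii) T̃_ξ(∂Ω) ∩ cl(Ω) = {ξ}. Then there exists an open ball B'_ξ, compactly contained in B_ξ and centred at ξ, such that T̃_q(∂Ω) ∩ cl(Ω) = {q} for every q ∈ ∂Ω ∩ B'_ξ. -/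
/-- `ρ` is a `C¹` defining function for `∂Ω` on the open set `B`:
`Ω ∩ B = {ρ < 0}`, `∂Ω ∩ B = {ρ = 0}`, and the (real) gradient of `ρ` is nonvanishing
on `∂Ω ∩ B`. -/
def IsDefiningFn {n : ℕ} (Ω B : Set (EuclideanSpace ℂ (Fin n)))
    (ρ : EuclideanSpace ℂ (Fin n) → ℝ) : Prop :=
  ContDiffOn ℝ 1 ρ B ∧
  Ω ∩ B = {x ∈ B | ρ x < 0} ∧
  frontier Ω ∩ B = {x ∈ B | ρ x = 0} ∧
  ∀ q ∈ frontier Ω ∩ B, fderiv ℝ ρ q ≠ 0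

/-- The affine tangent hyperplane `T̃_q(∂Ω) = q + {x : (x | ∇ρ(q)) = 0}` at `q`,
described via the real differential of the defining function `ρ`. -/
def tangentPlane {n : ℕ} (ρ : EuclideanSpace ℂ (Fin n) → ℝ)
    (q : EuclideanSpace ℂ (Fin n)) : Set (EuclideanSpace ℂ (Fin n)) :=
  {x | fderiv ℝ ρ q (x - q) = 0}

/-- Let `Ω ⊆ ℂⁿ` be a bounded domain, `ξ ∈ ∂Ω`, and `B_ξ` an open ball
centred at `ξ` admitting a `C¹` defining function `ρ` for `∂Ω`.  If
`T̃_q(∂Ω) ∩ cl(Ω) ∩ B_ξ = {q}` for every `q ∈ ∂Ω ∩ B_ξ` (strict convexity) and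
`T̃_ξ(∂Ω) ∩ cl(Ω) = {ξ}`, then there is an open ball `B'_ξ` compactly contained in `B_ξ`
and centred at `ξ` with `T̃_q(∂Ω) ∩ cl(Ω) = {q}` for every `q ∈ ∂Ω ∩ B'_ξ`. -/
theorem stmt3 (n : ℕ) (Ω : Set (EuclideanSpace ℂ (Fin n)))
    (hΩo : IsOpen Ω) (hΩc : IsConnected Ω) (hΩb : Bornology.IsBounded Ω)
    (ξ : EuclideanSpace ℂ (Fin n)) (hξ : ξ ∈ frontier Ω)
    (r : ℝ) (hr : 0 < r) (ρ : EuclideanSpace ℂ (Fin n) → ℝ)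
    (hρ : IsDefiningFn Ω (Metric.ball ξ r) ρ)
    (hstrict : ∀ q ∈ frontier Ω ∩ Metric.ball ξ r,
      tangentPlane ρ q ∩ closure Ω ∩ Metric.ball ξ r = {q})
    (hξt : tangentPlane ρ ξ ∩ closure Ω = {ξ}) :
    ∃ r' : ℝ, 0 < r' ∧ r' < r ∧
      ∀ q ∈ frontier Ω ∩ Metric.ball ξ r',
        tangentPlane ρ q ∩ closure Ω = {q} := by
  obtain ⟨hC, -, -, -⟩ := hρ
  have hξB : ξ ∈ Metric.ball ξ r := Metric.mem_ball_self hr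
  have hcont : ContinuousAt (fderiv ℝ ρ) ξ :=
    (hC.continuousOn_fderiv_of_isOpen Metric.isOpen_ball le_rfl).continuousAt
      (Metric.isOpen_ball.mem_nhds hξB)
  have hK : IsCompact (closure Ω \ Metric.ball ξ r) :=
    hΩb.isCompact_closure.diff Metric.isOpen_ball
  have hev : ∀ᶠ q in nhds ξ, ∀ x ∈ closure Ω \ Metric.ball ξ r,
      fderiv ℝ ρ q (x - q) ≠ 0 := by
    refine hK.eventually_forall_of_forall_eventually ?_
    intro x hx
    have hne : fderiv ℝ ρ ξ (x - ξ) ≠ 0 := by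
      intro h0
      have hmem : x ∈ tangentPlane ρ ξ ∩ closure Ω := ⟨h0, hx.1⟩
      rw [hξt] at hmem
      have hxe : x = ξ := hmem
      exact hx.2 (hxe ▸ hξB)
    have hc : ContinuousAt (fun z : EuclideanSpace ℂ (Fin n) × EuclideanSpace ℂ (Fin n) =>
        fderiv ℝ ρ z.1 (z.2 - z.1)) (ξ, x) := by
      have h1 : ContinuousAt (fun z : EuclideanSpace ℂ (Fin n) × EuclideanSpace ℂ (Fin n) =>
          fderiv ℝ ρ z.1) (ξ, x) :=
        ContinuousAt.comp (f := Prod.fst) (x := (ξ, x)) hcont continuousAt_fst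
      exact h1.clm_apply (continuousAt_snd.sub continuousAt_fst)
    exact hc.eventually_ne hne
  obtain ⟨ε, hε, hball⟩ := Metric.eventually_nhds_iff_ball.mp hev
  refine ⟨min ε (r / 2), lt_min hε (by linarith),
    lt_of_le_of_lt (min_le_right _ _) (by linarith), ?_⟩
  rintro q ⟨hqf, hq⟩
  have hqε : q ∈ Metric.ball ξ ε := Metric.ball_subset_ball (min_le_left _ _) hq
  have hqr : q ∈ Metric.ball ξ r :=
    Metric.ball_subset_ball ((min_le_right _ _).trans (by linarith)) hq
  rw [← hstrict q ⟨hqf, hqr⟩]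
  refine (Set.inter_eq_left.mpr ?_).symm
  rintro x ⟨hxt, hxc⟩
  by_contra hxB
  exact hball q hqε x ⟨hxc, hxB⟩ hxt
end

section
/- Let Ω ⊆ ℂⁿ, n ≥ 2, be a bounded domain, let ξ ∈ ∂Ω, and let B' be an open ball centred at ξ that admits a C¹ defining function for ∂Ω. Suppose Ω ∩ B' is convex and T̃_q(∂Ω) ∩ cl(Ω) = {q} for every q ∈ ∂Ω ∩ B'. Then there exists ε₀ > 0 such that for every w ∈ Ω with ‖w − ξ‖ < ε₀ there exist points s₁, …, s_n ∈ ∂Ω ∩ B' satisfying: (a) ‖s₁ − w‖ = sup{r > 0 : Bⁿ(w,r) ⊆ Ω}; (b) for j = 2, …, n, ‖s_j − w‖ = sup{r > 0 : B_w((span_ℂ{s₁−w, …, s_{j−1}−w})^⊥ ; r) ⊆ Ω}, where the orthogonal complement is taken with respect to the standard Hermitian inner product on ℂⁿ; (c) B_w(span_ℂ{s_j − w}; ‖s_j − w‖) ⊆ Ω ∩ B' for each j = 1, …, n; moreover the vectors e_j := (s_j − w)/‖s_j − w‖, j = 1, …, n, form an orthonormal n-tuple with respect to the standard Hermitian inner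 product. -/
/-- `B_w(V; r) = {z : z − w ∈ V and ‖z − w‖ < r}`. -/
def sliceBall {n : ℕ} (w : EuclideanSpace ℂ (Fin n))
    (V : Submodule ℂ (EuclideanSpace ℂ (Fin n))) (r : ℝ) :
    Set (EuclideanSpace ℂ (Fin n)) :=
  {z | z - w ∈ V ∧ ‖z - w‖ < r}

/-- Nearest frontier point in a nontrivial slice. -/
theorem slice_exists {n : ℕ} {Ω : Set (EuclideanSpace ℂ (Fin n))}
    (hΩo : IsOpen Ω) (hΩb : Bornology.IsBounded Ω)
    {w : EuclideanSpace ℂ (Fin n)} (hw : w ∈ Ω)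
    (V : Submodule ℂ (EuclideanSpace ℂ (Fin n))) (hV : V ≠ ⊥) :
    ∃ s, s ∈ frontier Ω ∧ s - w ∈ V ∧ s ≠ w ∧
      (∀ z ∈ frontier Ω, z - w ∈ V → ‖s - w‖ ≤ ‖z - w‖) ∧
      sliceBall w V ‖s - w‖ ⊆ Ω ∧
      ‖s - w‖ = sSup {t : ℝ | 0 < t ∧ sliceBall w V t ⊆ Ω} := by
  have key : ∀ z, z - w ∈ V → z ∉ Ω →
      ∃ y ∈ frontier Ω, y - w ∈ V ∧ ‖y - w‖ ≤ ‖z - w‖ := by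
    intro z hz hzΩ
    have hseg : IsPreconnected (segment ℝ w z) := (convex_segment w z).isPreconnected
    have h1 : (segment ℝ w z ∩ frontier Ω).Nonempty := by
      by_contra hno
      have hcov : segment ℝ w z ⊆ Ω ∪ (closure Ω)ᶜ := by
        intro x hx
        by_cases hxΩ : x ∈ Ω
        · exact Or.inl hxΩ
        · refine Or.inr fun hxc => hno ⟨x, hx, ?_⟩
          rw [hΩo.frontier_eq]
          exact ⟨hxc, hxΩ⟩
      have hzc : z ∈ (closure Ω)ᶜ :=
        (hcov (right_mem_segment ℝ w z)).resolve_left hzΩ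
      obtain ⟨x, -, hx1, hx2⟩ := hseg Ω (closure Ω)ᶜ hΩo isClosed_closure.isOpen_compl hcov
        ⟨w, left_mem_segment ℝ w z, hw⟩ ⟨z, right_mem_segment ℝ w z, hzc⟩
      exact hx2 (subset_closure hx1)
    obtain ⟨y, hy, hyf⟩ := h1
    rw [segment_eq_image'] at hy
    obtain ⟨θ, ⟨h0, h1⟩, rfl⟩ := hy
    refine ⟨_, hyf, ?_, ?_⟩
    · simp only [add_sub_cancel_left]
      rw [← Complex.coe_smul]
      exact V.smul_mem _ hz
    · simp only [add_sub_cancel_left, norm_smul, Real.norm_eq_abs, abs_of_nonneg h0]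
      exact mul_le_of_le_one_left (norm_nonneg _) h1
  have hcomp : IsCompact (frontier Ω ∩ {z | z - w ∈ V}) := by
    have hf : IsCompact (frontier Ω) :=
      Metric.isCompact_of_isClosed_isBounded isClosed_frontier
        (hΩb.closure.subset frontier_subset_closure)
    apply hf.inter_right
    exact (V.closed_of_finiteDimensional).preimage (by fun_prop : Continuous fun z => z - w)
  have hne : (frontier Ω ∩ {z | z - w ∈ V}).Nonempty := by
    obtain ⟨v, hvV, hv0⟩ := V.ne_bot_iff.1 hV
    obtain ⟨C, hC⟩ := hΩb.subset_ball w
    have hvn : 0 < ‖v‖ := norm_pos_iff.2 hv0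
    obtain ⟨y, hy, hyV, _⟩ := key (w + ((C / ‖v‖ : ℝ) : ℂ) • v)
      (by simpa using V.smul_mem _ hvV) (by
        intro h
        have := hC h
        rw [Metric.mem_ball, dist_eq_norm, add_sub_cancel_left, norm_smul, Complex.norm_real,
          Real.norm_eq_abs, abs_div, abs_of_pos hvn, div_mul_cancel₀ _ hvn.ne'] at this
        exact absurd (le_abs_self C) (not_le.2 this))
    exact ⟨y, hy, hyV⟩
  obtain ⟨s, ⟨hsf, hsV⟩, hmin⟩ := hcomp.exists_isMinOn hne
    (by fun_prop : Continuous fun z => ‖z - w‖).continuousOn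
  have hsΩ : s ∉ Ω := by
    rw [hΩo.frontier_eq] at hsf
    exact hsf.2
  have hsw : s ≠ w := by rintro rfl; exact hsΩ hw
  have hmin' : ∀ z ∈ frontier Ω, z - w ∈ V → ‖s - w‖ ≤ ‖z - w‖ :=
    fun z hz hzV => hmin ⟨hz, hzV⟩
  have hsub : sliceBall w V ‖s - w‖ ⊆ Ω := by
    rintro z ⟨hzV, hz⟩
    by_contra hzΩ
    obtain ⟨y, hy, hyV, hyz⟩ := key z hzV hzΩ
    linarith [hmin' y hy hyV]
  refine ⟨s, hsf, hsV, hsw, hmin', hsub, ?_⟩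
  have hg : IsGreatest {t : ℝ | 0 < t ∧ sliceBall w V t ⊆ Ω} ‖s - w‖ := by
    refine ⟨⟨norm_pos_iff.2 (sub_ne_zero.2 hsw), hsub⟩, ?_⟩
    rintro t ⟨_, ht⟩
    by_contra hlt
    exact hsΩ (ht ⟨hsV, not_le.1 hlt⟩)
  exact hg.csSup_eq.symm

/-- At a nearest frontier point, directions orthogonal to the normal are tangent. -/
theorem nearest_tangent {n : ℕ} {Ω : Set (EuclideanSpace ℂ (Fin n))}
    {ξ : EuclideanSpace ℂ (Fin n)} {r : ℝ} {ρ : EuclideanSpace ℂ (Fin n) → ℝ}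
    (hρ : IsDefiningFn Ω (Metric.ball ξ r) ρ)
    {w s : EuclideanSpace ℂ (Fin n)} (hs : s ∈ frontier Ω) (hsB : s ∈ Metric.ball ξ r)
    (hsw : s ≠ w) (hmin : ∀ z ∈ frontier Ω, ‖s - w‖ ≤ ‖z - w‖)
    (v : EuclideanSpace ℂ (Fin n)) (hv : inner ℂ (s - w) v = 0) :
    fderiv ℝ ρ s v = 0 := by
  obtain ⟨hC, -, hfr, -⟩ := hρ
  have hnh : Metric.ball ξ r ∈ nhds s := Metric.isOpen_ball.mem_nhds hsB
  have hρs : HasStrictFDerivAt ρ (fderiv ℝ ρ s) s :=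
    (hC.contDiffAt hnh).hasStrictFDerivAt (by norm_num)
  have hs0 : ρ s = 0 := by
    have : s ∈ frontier Ω ∩ Metric.ball ξ r := ⟨hs, hsB⟩
    rw [hfr] at this
    exact this.2
  let _ : InnerProductSpace ℝ (EuclideanSpace ℂ (Fin n)) := InnerProductSpace.rclikeToReal ℂ _
  have hφ : HasStrictFDerivAt (fun x : EuclideanSpace ℂ (Fin n) => ‖x - w‖ ^ 2)
      (2 • (innerSL ℝ (s - w))) s := by
    have h := (hasStrictFDerivAt_norm_sq (s - w)).comp s
      ((hasStrictFDerivAt_id (𝕜 := ℝ) s).sub_const w)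
    exact h
  have hext : IsLocalExtrOn (fun x : EuclideanSpace ℂ (Fin n) => ‖x - w‖ ^ 2)
      {x | ρ x = ρ s} s := by
    left
    filter_upwards [self_mem_nhdsWithin, mem_nhdsWithin_of_mem_nhds hnh] with x hx hxB
    have hx' : x ∈ frontier Ω ∩ Metric.ball ξ r := by
      rw [hfr]; exact ⟨hxB, by rw [← hs0]; exact hx⟩
    have := hmin x hx'.1
    gcongr
  obtain ⟨a, b, hab, heq⟩ := hext.exists_multipliers_of_hasStrictFDerivAt_1d hρs hφ
  have hsn : ‖s - w‖ ≠ 0 := norm_ne_zero_iff.2 (sub_ne_zero.2 hsw)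
  have hin : inner ℝ (s - w) v = 0 := by
    change RCLike.re (inner ℂ (s - w) v) = 0
    rw [hv]; simp
  generalize s - w = u at heq hsn hin
  have e1 := DFunLike.congr_fun heq v
  have e2 := DFunLike.congr_fun heq u
  have e1' : a * fderiv ℝ ρ s v + b * (2 * inner ℝ u v) = 0 := by
    simpa using e1
  have e2' : a * fderiv ℝ ρ s u + b * (2 * inner ℝ u u) = 0 := by
    simpa using e2
  rw [hin, mul_zero, mul_zero, add_zero] at e1'
  rw [real_inner_self_eq_norm_sq] at e2'
  rcases mul_eq_zero.1 e1' with h | h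
  · rw [h, zero_mul, zero_add] at e2'
    have hb : b = 0 := by simpa [hsn] using e2'
    exact absurd (by rw [h, hb]; rfl) hab
  · exact h

/-- Course-of-values recursion on `Fin n`. -/
theorem fin_rec_exists {n : ℕ} {w : EuclideanSpace ℂ (Fin n)}
    (G : Submodule ℂ (EuclideanSpace ℂ (Fin n)) → EuclideanSpace ℂ (Fin n)) :
    ∃ s : Fin n → EuclideanSpace ℂ (Fin n), ∀ j,
      s j = G (Submodule.span ℂ ((fun i => s i - w) '' {i : Fin n | i < j}))ᗮ := by
  let F : (j : Fin n) → ((i : Fin n) → i < j → EuclideanSpace ℂ (Fin n)) →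
      EuclideanSpace ℂ (Fin n) := fun j ih =>
    G (Submodule.span ℂ (Set.range fun i : {i : Fin n // i < j} => ih i.1 i.2 - w))ᗮ
  refine ⟨IsWellFounded.fix (· < ·) F, fun j => ?_⟩
  rw [IsWellFounded.fix_eq, Set.image_eq_range]
  rfl

/-- extremal boundary points `s₁, …, s_n` for points `w ∈ Ω` near a strictly
convexifiable boundary point `ξ`, together with the orthonormality of the associated
directions `e_j = (s_j − w)/‖s_j − w‖`. -/
theorem stmt4 (n : ℕ) (hn : 2 ≤ n) (Ω : Set (EuclideanSpace ℂ (Fin n)))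
    (hΩo : IsOpen Ω) (hΩc : IsConnected Ω) (hΩb : Bornology.IsBounded Ω)
    (ξ : EuclideanSpace ℂ (Fin n)) (hξ : ξ ∈ frontier Ω)
    (r : ℝ) (hr : 0 < r) (ρ : EuclideanSpace ℂ (Fin n) → ℝ)
    (hρ : IsDefiningFn Ω (Metric.ball ξ r) ρ)
    (hconv : Convex ℝ (Ω ∩ Metric.ball ξ r))
    (htang : ∀ q ∈ frontier Ω ∩ Metric.ball ξ r,
      tangentPlane ρ q ∩ closure Ω = {q}) :
    ∃ ε₀ : ℝ, 0 < ε₀ ∧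
      ∀ w ∈ Ω, ‖w - ξ‖ < ε₀ →
        ∃ s : Fin n → EuclideanSpace ℂ (Fin n),
          (∀ j, s j ∈ frontier Ω ∩ Metric.ball ξ r) ∧
          (‖s ⟨0, by omega⟩ - w‖ = sSup {t : ℝ | 0 < t ∧ Metric.ball w t ⊆ Ω}) ∧
          (∀ j : Fin n, j ≠ ⟨0, by omega⟩ →
            ‖s j - w‖ = sSup {t : ℝ | 0 < t ∧
              sliceBall w
                (Submodule.span ℂ ((fun i => s i - w) '' {i : Fin n | i < j}))ᗮ t ⊆ Ω}) ∧
          (∀ j, sliceBall w (Submodule.span ℂ {s j - w}) ‖s j - w‖ ⊆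
            Ω ∩ Metric.ball ξ r) ∧
          Orthonormal ℂ (fun j => (‖s j - w‖ : ℂ)⁻¹ • (s j - w)) := by
  have hξB : ξ ∈ frontier Ω ∩ Metric.ball ξ r := ⟨hξ, Metric.mem_ball_self hr⟩
  have hK : IsCompact (closure Ω \ Metric.ball ξ r) :=
    (Metric.isCompact_of_isClosed_isBounded isClosed_closure hΩb.closure).diff Metric.isOpen_ball
  have hcont : ContinuousAt (fderiv ℝ ρ) ξ :=
    (hρ.1.contDiffAt (Metric.ball_mem_nhds ξ hr)).continuousAt_fderiv (by norm_num)
  have hev : ∀ᶠ p : EuclideanSpace ℂ (Fin n) × EuclideanSpace ℂ (Fin n) in nhds (ξ, ξ),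
      ∀ x ∈ closure Ω \ Metric.ball ξ r, fderiv ℝ ρ p.1 (x - p.2) ≠ 0 := by
    apply hK.eventually_forall_of_forall_eventually
    intro x hx
    have h0 : fderiv ℝ ρ ξ (x - ξ) ≠ 0 := by
      intro h
      have hmem : x ∈ tangentPlane ρ ξ ∩ closure Ω := ⟨h, hx.1⟩
      rw [htang ξ hξB] at hmem
      rw [Set.mem_singleton_iff] at hmem
      exact hx.2 (hmem ▸ hξB.2)
    have hc : ContinuousAt (fun z : (EuclideanSpace ℂ (Fin n) × EuclideanSpace ℂ (Fin n)) ×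
        EuclideanSpace ℂ (Fin n) => fderiv ℝ ρ z.1.1 (z.2 - z.1.2)) ((ξ, ξ), x) := by
      apply ContinuousAt.clm_apply
      · exact ContinuousAt.comp (f := fun z : (EuclideanSpace ℂ (Fin n) ×
          EuclideanSpace ℂ (Fin n)) × EuclideanSpace ℂ (Fin n) => z.1.1) hcont (by fun_prop)
      · fun_prop
    exact hc.eventually_ne h0
  obtain ⟨ε, hε, hball⟩ := Metric.eventually_nhds_iff.1 hev
  refine ⟨min ε r / 2, by positivity, fun w hw hwξ => ?_⟩
  have hm1 := min_le_left ε r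
  have hm2 := min_le_right ε r
  choose! G hGf hGV hGw hGmin hGsub hGsup using slice_exists hΩo hΩb hw
  obtain ⟨s, hs⟩ := fin_rec_exists (w := w) G
  have hV : ∀ j : Fin n,
      (Submodule.span ℂ ((fun i => s i - w) '' {i : Fin n | i < j}))ᗮ ≠ ⊥ := by
    intro j h
    rw [Submodule.orthogonal_eq_bot_iff] at h
    have h1 : (Set.finrank ℂ ((((Finset.Iio j).image fun i => s i - w) :
        Finset (EuclideanSpace ℂ (Fin n))) : Set (EuclideanSpace ℂ (Fin n)))) ≤ _ :=
      finrank_span_finset_le_card _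
    have h2 := Finset.card_image_le (s := Finset.Iio j) (f := fun i => s i - w)
    have h3 : ((((Finset.Iio j).image fun i => s i - w) :
        Finset (EuclideanSpace ℂ (Fin n))) : Set (EuclideanSpace ℂ (Fin n))) =
        (fun i => s i - w) '' {i : Fin n | i < j} := by
      ext; simp
    rw [h3, Set.finrank, h, finrank_top, finrank_euclideanSpace_fin] at h1
    rw [Fin.card_Iio] at h2
    have := j.2
    omega
  set V : Fin n → Submodule ℂ (EuclideanSpace ℂ (Fin n)) := fun j =>
    (Submodule.span ℂ ((fun i => s i - w) '' {i : Fin n | i < j}))ᗮ with hVdef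
  have hsG : ∀ j, s j = G (V j) := hs
  have hV0 : V ⟨0, by omega⟩ = ⊤ := by
    have : {i : Fin n | i < ⟨0, by omega⟩} = ∅ := by
      ext i; simp [Fin.lt_def]
    simp [hVdef, this]
  have hsf : ∀ j, s j ∈ frontier Ω := fun j => by rw [hsG]; exact hGf _ (hV j)
  have hsV : ∀ j, s j - w ∈ V j := fun j => by rw [hsG]; exact hGV _ (hV j)
  have hsw : ∀ j, s j ≠ w := fun j => by rw [hsG]; exact hGw _ (hV j)
  have hssub : ∀ j, sliceBall w (V j) ‖s j - w‖ ⊆ Ω := fun j => by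
    rw [hsG]; exact hGsub _ (hV j)
  have hssup : ∀ j, ‖s j - w‖ = sSup {t : ℝ | 0 < t ∧ sliceBall w (V j) t ⊆ Ω} := fun j => by
    rw [hsG]; exact hGsup _ (hV j)
  have hmin0 : ∀ z ∈ frontier Ω, ‖s ⟨0, by omega⟩ - w‖ ≤ ‖z - w‖ := by
    intro z hz
    rw [hsG]
    exact hGmin _ (hV _) z hz (by change z - w ∈ V _; rw [hV0]; trivial)
  have hd0 : ‖s ⟨0, by omega⟩ - w‖ < min ε r / 2 := by
    have := hmin0 ξ hξ
    rw [norm_sub_rev ξ w] at this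
    linarith
  have hd1 : ‖s ⟨0, by omega⟩ - ξ‖ < min ε r := by
    have := norm_sub_le_norm_sub_add_norm_sub (s ⟨0, by omega⟩) w ξ
    linarith
  have hs0B : s ⟨0, by omega⟩ ∈ Metric.ball ξ r := by
    rw [mem_ball_iff_norm]; linarith
  have horth : ∀ i j : Fin n, i < j → inner ℂ (s i - w) (s j - w) = 0 := by
    intro i j hij
    exact (Submodule.mem_orthogonal _ _).1 (hsV j) _ (Submodule.subset_span ⟨i, hij, rfl⟩)
  have hloc : ∀ j : Fin n, j ≠ ⟨0, by omega⟩ → ∀ x ∈ closure Ω, x - w ∈ V j →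
      x ∈ Metric.ball ξ r := by
    intro j hj x hx hxV
    by_contra hxB
    have h0j : (⟨0, by omega⟩ : Fin n) < j := by
      rw [Fin.lt_def]
      exact Nat.pos_of_ne_zero fun h => hj (Fin.ext h)
    have hp : dist (s ⟨0, by omega⟩, w) (ξ, ξ) < ε := by
      rw [Prod.dist_eq, max_lt_iff, dist_eq_norm, dist_eq_norm]
      constructor
      · exact lt_of_lt_of_le hd1 hm1
      · have : 0 < min ε r := by positivity
        show ‖w - ξ‖ < ε
        linarith
    refine hball hp x ⟨hx, hxB⟩ ?_
    refine nearest_tangent hρ (hsf _) hs0B (hsw _) hmin0 _ ?_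
    exact (Submodule.mem_orthogonal _ _).1 hxV _ (Submodule.subset_span ⟨_, h0j, rfl⟩)
  refine ⟨s, fun j => ⟨hsf j, ?_⟩, ?_, fun j _ => hssup j, fun j z hz => ?_, ?_⟩
  · by_cases hj : j = ⟨0, by omega⟩
    · rw [hj]; exact hs0B
    · exact hloc j hj _ (frontier_subset_closure (hsf j)) (hsV j)
  · rw [hssup, hV0]
    congr 1
    ext t
    have : sliceBall w ⊤ t = Metric.ball w t := by
      ext z; simp [sliceBall, dist_eq_norm]
    simp [this]
  · have hzV : z - w ∈ V j :=
      (Submodule.span_le.2 (Set.singleton_subset_iff.2 (hsV j))) hz.1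
    have hzΩ : z ∈ Ω := hssub j ⟨hzV, hz.2⟩
    refine ⟨hzΩ, ?_⟩
    by_cases hj : j = ⟨0, by omega⟩
    · have h1 := hz.2
      rw [hj] at h1
      have := norm_sub_le_norm_sub_add_norm_sub z w ξ
      rw [mem_ball_iff_norm]; linarith
    · exact hloc j hj z (subset_closure hzΩ) hzV
  · constructor
    · intro j
      have : ‖s j - w‖ ≠ 0 := norm_ne_zero_iff.2 (sub_ne_zero.2 (hsw j))
      rw [norm_smul, norm_inv, Complex.norm_real, norm_norm, inv_mul_cancel₀ this]
    · intro i j hij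
      show inner ℂ _ _ = 0
      rw [inner_smul_left, inner_smul_right]
      rcases lt_or_gt_of_ne hij with h | h
      · rw [horth i j h]; simp
      · rw [← inner_conj_symm, horth j i h]; simp
end

section
/- Let Ω ⊆ ℂⁿ, n ≥ 2, be a bounded domain, let ξ ∈ ∂Ω, and let B be an open ball centred at ξ that admits a C¹ defining function for ∂Ω. Assume: Ω ∩ B is convex; T̃_q(∂Ω) ∩ cl(Ω) ∩ B = {q} for every q ∈ ∂Ω ∩ B; and T̃_ξ(∂Ω) ∩ cl(Ω) = {ξ}. Then there exist ε > 0 and a constant c > 0 depending only on n such that s_Ω(w) ≥ c for every w ∈ Ω with ‖w − ξ‖ < ε. -/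
/-- The squeezing function of a bounded domain `D ⊆ ℂⁿ`:
`s_D(z) = sup { r > 0 : ∃ injective holomorphic F : D → Bⁿ(0,1), F(z) = 0, Bⁿ(0,r) ⊆ F(D) }`. -/
noncomputable def squeezingFn (n : ℕ) (D : Set (EuclideanSpace ℂ (Fin n)))
    (z : EuclideanSpace ℂ (Fin n)) : ℝ :=
  sSup {r : ℝ | 0 < r ∧ ∃ F : EuclideanSpace ℂ (Fin n) → EuclideanSpace ℂ (Fin n),
    DifferentiableOn ℂ F D ∧ Set.InjOn F D ∧
    Set.MapsTo F D (Metric.ball 0 1) ∧ F z = 0 ∧ Metric.ball 0 r ⊆ F '' D}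

namespace SqueezeAux

/-- Polar-type set of complex functionals. -/
def polarK {n : ℕ} (Ω : Set (EuclideanSpace ℂ (Fin n))) (w : EuclideanSpace ℂ (Fin n)) :
    Set (Fin n → ℂ) :=
  {a | ∀ z ∈ Ω, (a ⬝ᵥ (z - w).ofLp).re ≤ 1}

lemma exists_complex_rep {n : ℕ} (l : EuclideanSpace ℂ (Fin n) →L[ℝ] ℝ) :
    ∃ a : Fin n → ℂ, ∀ x : EuclideanSpace ℂ (Fin n), (a ⬝ᵥ x.ofLp).re = l x := by
  classical
  refine ⟨fun i => (l (EuclideanSpace.single i 1) : ℂ)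
    - (l (EuclideanSpace.single i Complex.I) : ℂ) * Complex.I, fun x => ?_⟩
  have hx : x = ∑ i, ((x i).re • EuclideanSpace.single i (1:ℂ)
      + (x i).im • EuclideanSpace.single i Complex.I) := by
    ext j
    simp [Pi.single_apply, Finset.sum_add_distrib, Complex.re_add_im]
  conv_rhs => rw [hx]
  rw [map_sum]
  simp only [map_add, map_smul, dotProduct, Complex.re_sum]
  refine Finset.sum_congr rfl fun i _ => ?_
  simp
  ring

lemma polarK_compact {n : ℕ} {Ω : Set (EuclideanSpace ℂ (Fin n))} (ho : IsOpen Ω)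
    {w : EuclideanSpace ℂ (Fin n)} (hw : w ∈ Ω) : IsCompact (polarK Ω w) := by
  classical
  obtain ⟨s, hs, hsub⟩ := Metric.isOpen_iff.1 ho w hw
  have hclosed : IsClosed (polarK Ω w) := by
    have : polarK Ω w = ⋂ z ∈ Ω, {a : Fin n → ℂ | (a ⬝ᵥ (z - w).ofLp).re ≤ 1} := by
      ext a; simp [polarK]
    rw [this]
    refine isClosed_biInter fun z _ => isClosed_le ?_ continuous_const
    simp only [dotProduct]
    fun_prop
  refine Metric.isCompact_of_isClosed_isBounded hclosed ?_
  refine (Metric.isBounded_closedBall (x := (0 : Fin n → ℂ)) (r := 2 / s)).subset fun a ha => ?_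
  rw [mem_closedBall_zero_iff]
  refine (pi_norm_le_iff_of_nonneg (by positivity)).2 fun i => ?_
  by_cases h0 : a i = 0
  · rw [h0]; simp; positivity
  have hn0 : 0 < ‖a i‖ := norm_pos_iff.2 h0
  set u : ℂ := (s / 2 / ‖a i‖ : ℝ) * (starRingEnd ℂ) (a i) with hu
  have hun : ‖u‖ = s / 2 := by
    rw [hu, norm_mul, Complex.norm_real, RCLike.norm_conj, Real.norm_of_nonneg (by positivity)]
    field_simp
  have hz : w + EuclideanSpace.single i u ∈ Ω := by
    apply hsub
    rw [Metric.mem_ball, dist_eq_norm]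
    simp only [add_sub_cancel_left, EuclideanSpace.norm_single, hun]
    linarith
  have h1 := ha _ hz
  have h2 : a ⬝ᵥ (w + EuclideanSpace.single i u - w).ofLp = ((s / 2 * ‖a i‖ : ℝ) : ℂ) := by
    rw [add_sub_cancel_left]
    have h3 : a ⬝ᵥ (EuclideanSpace.single i u).ofLp = a i * u := by
      simp [dotProduct, Pi.single_apply]
    rw [h3]
    rw [hu, mul_left_comm, Complex.mul_conj, Complex.normSq_eq_norm_sq, ← Complex.ofReal_mul]
    congr 1
    field_simp
  rw [h2, Complex.ofReal_re] at h1
  rw [le_div_iff₀ hs]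
  linarith

lemma exists_basis {n : ℕ} {Ω : Set (EuclideanSpace ℂ (Fin n))} (ho : IsOpen Ω)
    (hb : Bornology.IsBounded Ω)
    {w : EuclideanSpace ℂ (Fin n)} (hw : w ∈ Ω) :
    ∃ A : Matrix (Fin n) (Fin n) ℂ, A.det ≠ 0 ∧ (∀ i, A i ∈ polarK Ω w) ∧
      ∀ a ∈ polarK Ω w, ∃ c : Fin n → ℂ, (∀ i, ‖c i‖ ≤ 1) ∧ a = A.transpose.mulVec c := by
  classical
  have hK := polarK_compact ho hw
  have hS : IsCompact (Set.univ.pi (fun _ : Fin n => polarK Ω w)) := isCompact_univ_pi fun _ => hK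
  -- a nondegenerate element
  obtain ⟨R, hR⟩ := hb.subset_ball w
  have hRpos : 0 < R := by
    have := hR hw
    simpa using this
  have hsmall : (fun i => (R⁻¹ : ℂ) • (Pi.single i 1 : Fin n → ℂ)) ∈
      Set.univ.pi (fun _ : Fin n => polarK Ω w) := by
    intro i _ z hz
    have h1 := hR hz
    rw [Metric.mem_ball, dist_eq_norm] at h1
    have h2 : ‖(z - w).ofLp i‖ ≤ ‖z - w‖ := PiLp.norm_apply_le (z - w) i
    rw [smul_dotProduct, single_dotProduct, one_mul, smul_eq_mul]
    refine (Complex.re_le_norm _).trans ?_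
    rw [norm_mul, norm_inv, Complex.norm_real, Real.norm_of_nonneg hRpos.le,
      inv_mul_le_iff₀ hRpos]
    linarith
  obtain ⟨A, hA, hmax⟩ := hS.exists_isMaxOn ⟨_, hsmall⟩
    (f := fun A : Fin n → Fin n → ℂ => ‖(Matrix.of A).det‖)
    (by
      apply Continuous.continuousOn
      refine continuous_norm.comp ?_
      exact Continuous.matrix_det continuous_id)
  have hdet : (Matrix.of A).det ≠ 0 := by
    have h1 := hmax hsmall
    simp only [Set.mem_ofPred_eq] at h1
    have h2 : (Matrix.of (fun i => (R⁻¹ : ℂ) • (Pi.single i 1 : Fin n → ℂ)))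
        = (R⁻¹ : ℂ) • (1 : Matrix (Fin n) (Fin n) ℂ) := by
      ext i j
      simp [Matrix.one_apply, Pi.single_apply, eq_comm]
    rw [h2, Matrix.det_smul, Matrix.det_one, mul_one] at h1
    intro h
    rw [h, norm_zero] at h1
    have : 0 < ‖(R⁻¹ : ℂ) ^ Fintype.card (Fin n)‖ := by
      rw [norm_pos_iff]
      apply pow_ne_zero
      simpa using hRpos.ne'
    linarith
  refine ⟨Matrix.of A, hdet, fun i => hA i trivial, fun a ha => ?_⟩
  refine ⟨fun j => (Matrix.of A).det⁻¹ * (Matrix.of A).transpose.cramer a j, fun j => ?_, ?_⟩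
  · beta_reduce
    rw [Matrix.cramer_transpose_apply, norm_mul, norm_inv, inv_mul_le_iff₀ (norm_pos_iff.2 hdet),
      mul_one]
    have hmem : Function.update A j a ∈ Set.univ.pi (fun _ : Fin n => polarK Ω w) := by
      intro i _
      by_cases hij : i = j
      · subst hij; simpa using ha
      · simpa [hij] using hA i trivial
    exact hmax hmem
  · have := Matrix.mulVec_cramer (Matrix.of A).transpose a
    rw [Matrix.det_transpose] at this
    have h3 : (fun j => (Matrix.of A).det⁻¹ * (Matrix.of A).transpose.cramer a j)
      = (Matrix.of A).det⁻¹ • (Matrix.of A).transpose.cramer a := rfl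
    rw [h3, Matrix.mulVec_smul, this, smul_smul, inv_mul_cancel₀ hdet, one_smul]

lemma cayley_norm_le {L : ℂ} (h : L.re ≤ 1) : 2 - L ≠ 0 ∧ ‖L / (2 - L)‖ ≤ 1 := by
  have h0 : 2 - L ≠ 0 := by
    intro h0
    have := congrArg Complex.re h0
    simp at this
    linarith
  refine ⟨h0, ?_⟩
  rw [norm_div, div_le_one (norm_pos_iff.2 h0)]
  apply abs_le_of_sq_le_sq' _ (norm_nonneg _) |>.2
  rw [← Complex.normSq_eq_norm_sq, ← Complex.normSq_eq_norm_sq, Complex.normSq_apply,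
    Complex.normSq_apply]
  simp
  nlinarith

lemma core {n : ℕ} (hn : 2 ≤ n) {Ω : Set (EuclideanSpace ℂ (Fin n))} (ho : IsOpen Ω)
    (hb : Bornology.IsBounded Ω) {w : EuclideanSpace ℂ (Fin n)} (hw : w ∈ Ω)
    (hP : ∀ z, (∀ a ∈ polarK Ω w, ‖a ⬝ᵥ (z - w).ofLp‖ < 1) → z ∈ Ω) :
    1 / (4 * ((n:ℝ) + 1) ^ 2) ≤ squeezingFn n Ω w := by
  classical
  obtain ⟨A, hdet, hAK, hspan⟩ := exists_basis ho hb hw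
  have hn1 : (0:ℝ) < (n:ℝ) + 1 := by positivity
  have hn1c : ((n:ℂ) + 1) ≠ 0 := by exact_mod_cast hn1.ne'
  have hnn : ‖((n:ℂ) + 1)‖ = (n:ℝ) + 1 := by
    have : ((n:ℂ) + 1) = (((n:ℝ) + 1 : ℝ) : ℂ) := by push_cast; rfl
    rw [this, Complex.norm_real, Real.norm_of_nonneg hn1.le]
  apply le_csSup
  · refine ⟨1, ?_⟩
    rintro r ⟨hr, F, -, -, hm, -, hsub⟩
    by_contra! h1
    have hin : (EuclideanSpace.single (⟨0, by omega⟩ : Fin n) (1:ℂ)) ∈ Metric.ball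
      (0 : EuclideanSpace ℂ (Fin n)) r := by
      simpa using h1
    obtain ⟨z, hz, hFz⟩ := hsub hin
    have := hm hz
    rw [hFz] at this
    simp at this
  · refine ⟨by positivity, fun z => WithLp.toLp 2 fun i =>
      ((n:ℂ) + 1)⁻¹ * ((A i ⬝ᵥ (z - w).ofLp) / (2 - A i ⬝ᵥ (z - w).ofLp)), ?_, ?_, ?_, ?_, ?_⟩
    · rw [differentiableOn_euclidean]
      intro i
      simp only [dotProduct]
      have hd : Differentiable ℂ (fun z : EuclideanSpace ℂ (Fin n) =>
          ∑ j, A i j * (z - w).ofLp j) := by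
        simp only [PiLp.sub_apply]
        fun_prop
      refine DifferentiableOn.const_mul ?_ _
      have hd2 : Differentiable ℂ (fun z : EuclideanSpace ℂ (Fin n) =>
          2 - ∑ j, A i j * (z - w).ofLp j) := hd.const_sub 2
      intro z hz
      have hz0 : 2 - ∑ j, A i j * (z - w).ofLp j ≠ 0 := (cayley_norm_le (hAK i z hz)).1
      simp only [div_eq_mul_inv]
      exact ((hd z).fun_mul ((hd2 z).fun_inv hz0)).differentiableWithinAt
    · intro z hz z' hz' h
      have hL : A.mulVec (z - w).ofLp = A.mulVec (z' - w).ofLp := by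
        funext i
        have hi := congrArg (fun v : EuclideanSpace ℂ (Fin n) => v i) h
        simp only at hi
        have h1 := (cayley_norm_le (hAK i z hz)).1
        have h2 := (cayley_norm_le (hAK i z' hz')).1
        have h3 := mul_left_cancel₀ (inv_ne_zero hn1c) hi
        rw [div_eq_div_iff h1 h2] at h3
        change A i ⬝ᵥ (z - w).ofLp = A i ⬝ᵥ (z' - w).ofLp
        linear_combination h3 / 2
      have := Matrix.mulVec_injective_of_isUnit ((Matrix.isUnit_iff_isUnit_det A).2
        (isUnit_iff_ne_zero.2 hdet)) hL
      have h4 : z - w = z' - w := by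
        ext i; exact congrFun this i
      exact sub_left_injective h4
    · intro z hz
      rw [mem_ball_zero_iff]
      have h1 : ‖(WithLp.toLp 2 fun i =>
        ((n:ℂ) + 1)⁻¹ * ((A i ⬝ᵥ (z - w).ofLp) / (2 - A i ⬝ᵥ (z - w).ofLp)) :
          EuclideanSpace ℂ (Fin n))‖ ^ 2 < 1 := by
        rw [EuclideanSpace.norm_sq_eq]
        have : ∀ i ∈ (Finset.univ : Finset (Fin n)), ‖((n:ℂ) + 1)⁻¹ *
            ((A i ⬝ᵥ (z - w).ofLp) / (2 - A i ⬝ᵥ (z - w).ofLp))‖ ^ 2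
            ≤ (((n:ℝ) + 1)⁻¹) ^ 2 := by
          intro i _
          have := (cayley_norm_le (hAK i z hz)).2
          rw [norm_mul, norm_inv, hnn]
          gcongr
          exact mul_le_of_le_one_right (by positivity) this
        refine (Finset.sum_le_sum this).trans_lt ?_
        rw [Finset.sum_const, Finset.card_univ, Fintype.card_fin, nsmul_eq_mul, inv_pow,
          ← div_eq_mul_inv, div_lt_one (by positivity)]
        nlinarith
      exact (sq_lt_one_iff₀ (norm_nonneg _)).1 h1
    · ext i
      simp
    · intro y hy
      rw [mem_ball_zero_iff] at hy
      set ζ : Fin n → ℂ := fun i => ((n:ℂ) + 1) * y i with hζ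
      have hζn : ∀ i, ‖ζ i‖ < 1 / (4 * ((n:ℝ) + 1)) := by
        intro i
        have h2 : ‖y i‖ ≤ ‖y‖ := PiLp.norm_apply_le y i
        simp only [hζ, norm_mul, hnn]
        have h3 : ‖y i‖ < 1 / (4 * ((n:ℝ) + 1) ^ 2) := h2.trans_lt hy
        calc ((n:ℝ) + 1) * ‖y i‖ < ((n:ℝ) + 1) * (1 / (4 * ((n:ℝ) + 1) ^ 2)) := by gcongr
          _ = _ := by field_simp
      have hζ4 : ∀ i, ‖ζ i‖ < 1 / 4 := by
        intro i
        refine (hζn i).trans_le ?_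
        apply one_div_le_one_div_of_le (by norm_num)
        nlinarith
      have hone : ∀ i, 3 / 4 ≤ ‖1 + ζ i‖ := by
        intro i
        have h1 : ‖(1:ℂ)‖ ≤ ‖1 + ζ i‖ + ‖ζ i‖ := by
          have := norm_sub_le (1 + ζ i) (ζ i)
          simpa using this
        rw [norm_one] at h1
        have := hζ4 i
        linarith
      have hne : ∀ i, 1 + ζ i ≠ 0 := fun i => norm_pos_iff.1 (by linarith [hone i])
      set L : Fin n → ℂ := fun i => 2 * ζ i / (1 + ζ i) with hL
      have hLn : ∀ i, ‖L i‖ < 1 / ((n:ℝ) + 1) := by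
        intro i
        simp only [hL, norm_div, norm_mul, Complex.norm_ofNat]
        rw [div_lt_iff₀ (by linarith [hone i])]
        have h1 := hζn i
        have h2 : 1 / (4 * ((n:ℝ) + 1)) = 1 / 4 * (1 / ((n:ℝ) + 1)) := by field_simp
        rw [h2] at h1
        have h3 : 0 < 1 / ((n:ℝ) + 1) := by positivity
        nlinarith [hone i]
      have hAu : IsUnit A.det := isUnit_iff_ne_zero.2 hdet
      have hAL : A.mulVec (A⁻¹.mulVec L) = L := by
        rw [Matrix.mulVec_mulVec, Matrix.mul_nonsing_inv _ hAu, Matrix.one_mulVec]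
      have hzi : ∀ i, A i ⬝ᵥ (w + WithLp.toLp 2 (A⁻¹.mulVec L) - w).ofLp = L i := by
        intro i
        rw [add_sub_cancel_left]
        exact congrFun hAL i
      refine ⟨w + WithLp.toLp 2 (A⁻¹.mulVec L), hP _ ?_, ?_⟩
      · intro a ha
        obtain ⟨c, hc, rfl⟩ := hspan a ha
        rw [add_sub_cancel_left, Matrix.mulVec_transpose, ← Matrix.dotProduct_mulVec, hAL]
        refine (norm_sum_le _ _).trans_lt ?_
        have : ∀ i ∈ (Finset.univ : Finset (Fin n)), ‖c i * L i‖ ≤ 1 / ((n:ℝ) + 1) := by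
          intro i _
          rw [norm_mul]
          have := hc i
          have h2 := (hLn i).le
          calc ‖c i‖ * ‖L i‖ ≤ 1 * (1 / ((n:ℝ) + 1)) := by gcongr
            _ = _ := one_mul _
        refine (Finset.sum_le_sum this).trans_lt ?_
        rw [Finset.sum_const, Finset.card_univ, Fintype.card_fin, nsmul_eq_mul, mul_one_div,
          div_lt_one hn1]
        linarith
      · ext i
        simp only [hzi]
        have h1 := hne i
        have h2 : 2 - L i = 2 / (1 + ζ i) := by
          simp only [hL]; field_simp; ring
        rw [h2]
        simp only [hL]
        have h3 : 2 * ζ i / (1 + ζ i) / (2 / (1 + ζ i)) = ζ i := by field_simp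
        rw [h3]
        simp only [hζ]
        field_simp

/-- local support from convexity -/
lemma local_support {n : ℕ} {Ω : Set (EuclideanSpace ℂ (Fin n))} (ho : IsOpen Ω)
    {ξ : EuclideanSpace ℂ (Fin n)} {r : ℝ} {ρ : EuclideanSpace ℂ (Fin n) → ℝ}
    (hρ : IsDefiningFn Ω (Metric.ball ξ r) ρ) (hc : Convex ℝ (Ω ∩ Metric.ball ξ r))
    {q : EuclideanSpace ℂ (Fin n)} (hq : q ∈ frontier Ω ∩ Metric.ball ξ r)
    {x : EuclideanSpace ℂ (Fin n)} (hx : x ∈ Ω ∩ Metric.ball ξ r) :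
    fderiv ℝ ρ q (x - q) ≤ 0 := by
  obtain ⟨hcd, hneg, hzero, -⟩ := hρ
  have hdiff : DifferentiableAt ℝ ρ q :=
    (hcd.differentiableOn (by norm_num)).differentiableAt (Metric.isOpen_ball.mem_nhds hq.2)
  have hq0 : ρ q = 0 := by
    have : q ∈ {x ∈ Metric.ball ξ r | ρ x = 0} := hzero ▸ hq
    exact this.2
  have hqcl : q ∈ closure (Ω ∩ Metric.ball ξ r) := by
    rw [Set.inter_comm]
    exact Metric.isOpen_ball.inter_closure ⟨hq.2, frontier_subset_closure hq.1⟩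
  have hopen : IsOpen (Ω ∩ Metric.ball ξ r) := ho.inter Metric.isOpen_ball
  have hline : HasDerivAt (fun t : ℝ => ρ (q + t • (x - q))) (fderiv ℝ ρ q (x - q)) 0 := by
    have h1 : HasFDerivAt ρ (fderiv ℝ ρ q) (q + (0:ℝ) • (x - q)) := by
      simpa using hdiff.hasFDerivAt
    have h2 : HasDerivAt (fun t : ℝ => q + t • (x - q)) (x - q) 0 := by
      simpa using ((hasDerivAt_id (0:ℝ)).smul_const (x - q)).const_add q
    exact h1.comp_hasDerivAt 0 h2
  have hseg : ∀ t ∈ Set.Ioo (0:ℝ) 1, ρ (q + t • (x - q)) < 0 := by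
    intro t ht
    have hm : q + t • (x - q) ∈ openSegment ℝ q x := by
      rw [openSegment_eq_image']
      exact ⟨t, ht, rfl⟩
    have hm2 := hc.openSegment_closure_interior_subset_interior hqcl
      (by rwa [hopen.interior_eq]) hm
    rw [hopen.interior_eq, hneg] at hm2
    exact hm2.2
  have hs := hline.hasDerivWithinAt (s := Set.Ioi 0)
  rw [hasDerivWithinAt_iff_tendsto_slope' (by simp)] at hs
  refine le_of_tendsto hs ?_
  filter_upwards [Ioo_mem_nhdsGT (zero_lt_one' ℝ)] with t ht
  rw [slope_def_field]
  simp only [zero_smul, add_zero, hq0, sub_zero]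
  exact div_nonpos_of_nonpos_of_nonneg (hseg t ht).le ht.1.le

/-- A supporting real functional gives an element of `polarK`. -/
lemma mem_polarK_of_support {n : ℕ} {Ω : Set (EuclideanSpace ℂ (Fin n))}
    {w q : EuclideanSpace ℂ (Fin n)} (l : EuclideanSpace ℂ (Fin n) →L[ℝ] ℝ)
    (hl : ∀ x ∈ Ω, l (x - q) ≤ 0) (hw : l (w - q) < 0) :
    ∃ a ∈ polarK Ω w, ∀ x, (a ⬝ᵥ x.ofLp).re = l x / (- l (w - q)) := by
  obtain ⟨a, ha⟩ := exists_complex_rep ((- l (w - q))⁻¹ • l)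
  have ha' : ∀ x : EuclideanSpace ℂ (Fin n), (a ⬝ᵥ x.ofLp).re = l x / (- l (w - q)) := by
    intro x
    rw [ha x, smul_apply, smul_eq_mul, div_eq_inv_mul]
  refine ⟨a, fun z hz => ?_, ha'⟩
  rw [ha', div_le_one (by linarith)]
  have h1 := hl z hz
  have h2 : l (z - w) = l (z - q) - l (w - q) := by rw [← map_sub]; congr 1; abel
  linarith

end SqueezeAux

open SqueezeAux

/-- near a boundary point `ξ` of a bounded domain `Ω ⊆ ℂⁿ` (`n ≥ 2`) at which
`Ω` is locally convex with strictly convex `C¹` boundary whose tangent hyperplane at `ξ`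
meets `cl(Ω)` only at `ξ`, the squeezing function admits a positive lower bound `c`
depending only on `n`. -/
theorem stmt6 (n : ℕ) (hn : 2 ≤ n) :
    ∃ c : ℝ, 0 < c ∧
      ∀ (Ω : Set (EuclideanSpace ℂ (Fin n))),
        IsOpen Ω → IsConnected Ω → Bornology.IsBounded Ω →
        ∀ ξ ∈ frontier Ω, ∀ r : ℝ, 0 < r →
        ∀ ρ : EuclideanSpace ℂ (Fin n) → ℝ,
          IsDefiningFn Ω (Metric.ball ξ r) ρ →
          Convex ℝ (Ω ∩ Metric.ball ξ r) →
          (∀ q ∈ frontier Ω ∩ Metric.ball ξ r,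
            tangentPlane ρ q ∩ closure Ω ∩ Metric.ball ξ r = {q}) →
          tangentPlane ρ ξ ∩ closure Ω = {ξ} →
          ∃ ε : ℝ, 0 < ε ∧ ∀ w ∈ Ω, ‖w - ξ‖ < ε → c ≤ squeezingFn n Ω w := by
  refine ⟨1 / (4 * ((n:ℝ) + 1) ^ 2), by positivity, ?_⟩
  intro Ω ho hconn hb ξ hξ r hr ρ hρ hc hstrict hglob
  have hξB : ξ ∈ frontier Ω ∩ Metric.ball ξ r := ⟨hξ, Metric.mem_ball_self hr⟩
  have hfr : ∀ q ∈ frontier Ω, q ∉ Ω := by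
    intro q hq hqΩ
    rw [ho.frontier_eq] at hq
    exact hq.2 hqΩ
  set l := fderiv ℝ ρ ξ with hl
  -- Ω lies on the negative side
  have hne : ∀ x ∈ Ω, l (x - ξ) ≠ 0 := by
    intro x hx h0
    have : x ∈ tangentPlane ρ ξ ∩ closure Ω := ⟨h0, subset_closure hx⟩
    rw [hglob] at this
    rw [Set.mem_singleton_iff] at this
    exact hfr ξ hξ (this ▸ hx)
  obtain ⟨x0, hx0⟩ : (Ω ∩ Metric.ball ξ r).Nonempty := by
    have := mem_closure_iff.1 (frontier_subset_closure hξ) _ Metric.isOpen_ball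
      (Metric.mem_ball_self hr)
    rwa [Set.inter_comm] at this
  have hx0neg : l (x0 - ξ) < 0 :=
    lt_of_le_of_ne (local_support ho hρ hc hξB hx0) (hne x0 hx0.1)
  have hcont : Continuous (fun x : EuclideanSpace ℂ (Fin n) => l (x - ξ)) := by fun_prop
  have hneg : ∀ x ∈ Ω, l (x - ξ) < 0 := by
    intro x hx
    by_contra! h
    obtain ⟨y, hy, hy0⟩ := hconn.isPreconnected.intermediate_value hx0.1 hx hcont.continuousOn
      (⟨hx0neg.le, h⟩ : (0:ℝ) ∈ Set.Icc _ _)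
    exact hne y hy hy0
  have hnegcl : ∀ x ∈ closure Ω, l (x - ξ) ≤ 0 := by
    intro x hx
    exact closure_minimal (fun y hy => (hneg y hy).le)
      (isClosed_le hcont continuous_const) hx
  -- exposedness
  have hexp : ∀ δ : ℝ, 0 < δ → ∃ η : ℝ, 0 < η ∧ ∀ x ∈ closure Ω, -η < l (x - ξ) →
      x ∈ Metric.ball ξ δ := by
    intro δ hδ
    have hcomp : IsCompact (closure Ω \ Metric.ball ξ δ) :=
      hb.isCompact_closure.diff Metric.isOpen_ball
    rcases (closure Ω \ Metric.ball ξ δ).eq_empty_or_nonempty with he | hne'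
    · refine ⟨1, one_pos, fun x hx _ => ?_⟩
      exact Set.diff_eq_empty.1 he hx
    · obtain ⟨m, hm, hmax⟩ := hcomp.exists_isMaxOn hne' hcont.continuousOn
      have hm0 : l (m - ξ) < 0 := by
        refine lt_of_le_of_ne (hnegcl m hm.1) fun h0 => ?_
        have : m ∈ tangentPlane ρ ξ ∩ closure Ω := ⟨h0, hm.1⟩
        rw [hglob, Set.mem_singleton_iff] at this
        exact hm.2 (this ▸ Metric.mem_ball_self hδ)
      refine ⟨- l (m - ξ), by linarith, fun x hx hlt => ?_⟩
      by_contra hxb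
      have := hmax (⟨hx, hxb⟩ : x ∈ closure Ω \ Metric.ball ξ δ)
      simp only [Set.mem_ofPred_eq] at this
      linarith
  -- uniform global support
  obtain ⟨δ, hδ, hδr, hsupp⟩ : ∃ δ : ℝ, 0 < δ ∧ δ ≤ r ∧ ∀ q ∈ frontier Ω ∩ Metric.ball ξ δ,
      ∀ x ∈ Ω, fderiv ℝ ρ q (x - q) ≤ 0 := by
    obtain ⟨η, hη, hηx⟩ := hexp r hr
    obtain ⟨R, hR⟩ := hb.subset_ball ξ
    have hRpos : 0 < R := by
      have := hR hx0.1
      exact dist_nonneg.trans_lt this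
    have hcf : ContinuousAt (fderiv ℝ ρ) ξ :=
      (hρ.1.continuousOn_fderiv_of_isOpen Metric.isOpen_ball le_rfl).continuousAt
        (Metric.isOpen_ball.mem_nhds (Metric.mem_ball_self hr))
    have hcg : ContinuousAt (fun q => ‖fderiv ℝ ρ q - l‖ * R + ‖fderiv ℝ ρ q‖ * ‖ξ - q‖) ξ := by
      fun_prop
    have hev : ∀ᶠ q in nhds ξ, ‖fderiv ℝ ρ q - l‖ * R + ‖fderiv ℝ ρ q‖ * ‖ξ - q‖ < η := by
      apply hcg.eventually_lt_const
      simpa [hl] using hη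
    obtain ⟨δ, hδ, hδq⟩ := Metric.eventually_nhds_iff_ball.1 hev
    refine ⟨min δ r, lt_min hδ hr, min_le_right _ _, ?_⟩
    rintro q ⟨hqf, hq⟩ x hx
    have hq1 : q ∈ Metric.ball ξ δ := Metric.ball_subset_ball (min_le_left _ _) hq
    have hq2 : q ∈ Metric.ball ξ r := Metric.ball_subset_ball (min_le_right _ _) hq
    by_cases hxr : x ∈ Metric.ball ξ r
    · exact local_support ho hρ hc ⟨hqf, hq2⟩ ⟨hx, hxr⟩
    · have h1 : l (x - ξ) ≤ -η := by
        by_contra! h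
        exact hxr (hηx x (subset_closure hx) h)
      have h2 := hδq q hq1
      have h3 : fderiv ℝ ρ q (x - q) = l (x - ξ) + (fderiv ℝ ρ q - l) (x - ξ)
          + fderiv ℝ ρ q (ξ - q) := by
        rw [ContinuousLinearMap.sub_apply, add_sub_cancel, ← map_add]
        congr 1; abel
      have h4 : (fderiv ℝ ρ q - l) (x - ξ) ≤ ‖fderiv ℝ ρ q - l‖ * R := by
        refine (le_abs_self _).trans (((fderiv ℝ ρ q - l).le_opNorm (x - ξ)).trans ?_)
        have := hR hx
        rw [Metric.mem_ball, dist_eq_norm] at this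
        gcongr
      have h5 : fderiv ℝ ρ q (ξ - q) ≤ ‖fderiv ℝ ρ q‖ * ‖ξ - q‖ :=
        (le_abs_self _).trans ((fderiv ℝ ρ q).le_opNorm (ξ - q))
      linarith
  obtain ⟨η, hη, hηx⟩ := hexp δ hδ
  obtain ⟨ε₁, hε₁, hε₁w⟩ := Metric.eventually_nhds_iff_ball.1
    ((hcont.continuousAt (x := ξ)).eventually_const_lt (u := -(η / 2)) (by simpa using hη))
  refine ⟨min ε₁ r, lt_min hε₁ hr, fun w hw hwξ => ?_⟩
  have hw1 : -(η / 2) < l (w - ξ) := hε₁w w (by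
    rw [Metric.mem_ball, dist_eq_norm]; exact hwξ.trans_le (min_le_left _ _))
  have hwr : w ∈ Metric.ball ξ r := by
    rw [Metric.mem_ball, dist_eq_norm]; exact hwξ.trans_le (min_le_right _ _)
  have hwneg := hneg w hw
  refine core hn ho hb hw fun z hz => ?_
  by_contra hzΩ
  obtain ⟨q, hqs, hqf⟩ : (segment ℝ w z ∩ frontier Ω).Nonempty := by
    by_contra hemp
    have hnf : ∀ y ∈ segment ℝ w z, y ∉ frontier Ω := fun y hy hyf => hemp ⟨y, hy, hyf⟩
    have hout : ∀ y ∈ segment ℝ w z, y ∉ Ω → y ∉ closure Ω := by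
      intro y hy hyΩ hycl
      apply hnf y hy
      rw [ho.frontier_eq]
      exact ⟨hycl, hyΩ⟩
    obtain ⟨y, -, hy1, hy2⟩ := (convex_segment w z).isPreconnected Ω (closure Ω)ᶜ ho
      isClosed_closure.isOpen_compl
      (fun y hy => by
        by_cases h : y ∈ Ω
        · exact Or.inl h
        · exact Or.inr (hout y hy h))
      ⟨w, left_mem_segment ℝ w z, hw⟩
      ⟨z, right_mem_segment ℝ w z, hout z (right_mem_segment ℝ w z) hzΩ⟩
    exact hy2 (subset_closure hy1)
  have hq : ∀ a ∈ polarK Ω w, ‖a ⬝ᵥ (q - w).ofLp‖ < 1 := by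
    intro a ha
    rw [segment_eq_image'] at hqs
    obtain ⟨t, ht, rfl⟩ := hqs
    have h1 : (w + t • (z - w) - w).ofLp = t • (z - w).ofLp := by
      rw [add_sub_cancel_left]; rfl
    rw [h1, dotProduct_smul, norm_smul, Real.norm_of_nonneg ht.1]
    have := hz a ha
    nlinarith [ht.1, ht.2, norm_nonneg (a ⬝ᵥ (z - w).ofLp)]
  -- q is close to ξ
  have hqδ : q ∈ Metric.ball ξ δ := by
    apply hηx q (frontier_subset_closure hqf)
    obtain ⟨a, ha, har⟩ := mem_polarK_of_support (w := w) (q := ξ) l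
      (fun x hx => (hneg x hx).le) hwneg
    have h1 := hq a ha
    have h2 := (abs_lt.1 ((Complex.abs_re_le_norm _).trans_lt h1)).1
    rw [har, lt_div_iff₀ (by linarith)] at h2
    have h3 : l (q - ξ) = l (q - w) + l (w - ξ) := by rw [← map_add]; congr 1; abel
    linarith
  have hqr : q ∈ frontier Ω ∩ Metric.ball ξ r := ⟨hqf, Metric.ball_subset_ball hδr hqδ⟩
  have hs := hsupp q ⟨hqf, hqδ⟩
  have hws : fderiv ℝ ρ q (w - q) < 0 := by
    refine lt_of_le_of_ne (hs w hw) fun h0 => ?_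
    have : w ∈ tangentPlane ρ q ∩ closure Ω ∩ Metric.ball ξ r :=
      ⟨⟨h0, subset_closure hw⟩, hwr⟩
    rw [hstrict q hqr, Set.mem_singleton_iff] at this
    exact hfr q hqf (this ▸ hw)
  obtain ⟨a, ha, har⟩ := mem_polarK_of_support (fderiv ℝ ρ q) hs hws
  have h1 := (Complex.re_le_norm _).trans_lt (hq a ha)
  rw [har, ← neg_sub w q, map_neg, div_self (by linarith)] at h1
  exact lt_irrefl _ h1
end

section
/- Let Ω ⊆ ℂⁿ, n ≥ 2, be a bounded domain and let K ⊆ Ω be a nonempty compact set such that D := Ω ∖ K is connected. Then for every p ∈ K ∩ ∂D, s_D(z) → 0 as z → p with z ∈ D. In particular, D is not holomorphic homogeneous regular, i.e., inf_{z ∈ D} s_D(z) = 0. -/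
section Helpers

open Set Filter Topology MeasureTheory Metric

/-- A Radó-type propagation of zeros. -/
theorem rado_ball {E F : Type*} [NormedAddCommGroup E] [NormedSpace ℂ E]
    [NormedAddCommGroup F] [NormedSpace ℂ F] {h : E → F} {b : E} {R : ℝ}
    (hc : ContinuousOn h (ball b R))
    (hd : ∀ x ∈ ball b R, h x ≠ 0 → DifferentiableAt ℂ h x)
    (hb : ∀ᶠ x in 𝓝 b, h x = 0) : ∀ x ∈ ball b R, h x = 0 := by
  intro a ha
  by_contra hne
  have hab : a ≠ b := by
    rintro rfl; exact hne hb.self_of_nhds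
  have hd0 : 0 < dist a b := dist_pos.2 hab
  have had : dist a b < R := ha
  -- reduce to the line
  set v : E := a - b with hv
  have hvn : ‖v‖ = dist a b := by rw [hv, dist_eq_norm]
  obtain ⟨T, hT1, hT2⟩ : ∃ T : ℝ, 1 < T ∧ T * dist a b < R := by
    have : 1 < R / dist a b := (one_lt_div hd0).2 had
    obtain ⟨T, h1, h2⟩ := exists_between this
    exact ⟨T, h1, (lt_div_iff₀ hd0).1 h2⟩
  let L : ℂ → E := fun ζ => b + ζ • v
  have hLc : Continuous L := by fun_prop
  have hLd : Differentiable ℂ L := by fun_prop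
  have hLm : ∀ ζ ∈ closedBall (0 : ℂ) T, L ζ ∈ ball b R := by
    intro ζ hζ
    simp only [mem_closedBall, dist_zero_right] at hζ
    simp only [L, mem_ball, dist_eq_norm, add_sub_cancel_left, norm_smul]
    calc _ ≤ T * dist a b := by rw [← hvn]; gcongr
      _ < R := hT2
  let g : ℂ → F := fun ζ => h (L ζ)
  have hgc : ContinuousOn g (closedBall 0 T) := hc.comp hLc.continuousOn hLm
  obtain ⟨M, hM⟩ : ∃ M, ∀ ζ ∈ closedBall (0 : ℂ) T, ‖g ζ‖ ≤ M :=
    (isCompact_closedBall (0 : ℂ) T).exists_bound_of_continuousOn hgc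
  have hg0 : ∀ᶠ ζ in 𝓝 (0 : ℂ), g ζ = 0 := by
    have : Tendsto L (𝓝 0) (𝓝 b) := by
      have := hLc.tendsto 0
      simpa [L] using this
    exact this.eventually hb
  obtain ⟨ρ, hρ, hρ0⟩ := Metric.eventually_nhds_iff_ball.1 hg0
  let W : Set ℂ := ball 0 T ∩ {ζ | g ζ ≠ 0}
  have hWo : IsOpen W := by
    have h1 : ContinuousOn g (ball 0 T) := hgc.mono ball_subset_closedBall
    exact h1.isOpen_inter_preimage isOpen_ball isOpen_compl_singleton
  have hWcl : closure W ⊆ closedBall 0 T :=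
    (closure_mono inter_subset_left).trans closure_ball_subset_closedBall
  have hWρ : closure W ⊆ (ball 0 ρ)ᶜ := by
    apply closure_minimal _ isOpen_ball.isClosed_compl
    intro ζ hζ hζ'
    exact hζ.2 (hρ0 ζ hζ')
  have hW0 : ∀ ζ ∈ closure W, ζ ≠ 0 := by
    rintro ζ hζ rfl
    exact hWρ hζ (mem_ball_self hρ)
  have h1W : (1 : ℂ) ∈ W := by
    refine ⟨by simpa using hT1, ?_⟩
    simpa [g, L, hv] using hne
  have key : ∀ m : ℕ, ‖h a‖ ≤ M * (1 / T) ^ m := by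
    intro m
    let k : ℂ → F := fun ζ => ((T : ℂ) / ζ) ^ m • g ζ
    have hk : DiffContOnCl ℂ k W := by
      constructor
      · intro ζ hζ
        have hζ0 := hW0 ζ (subset_closure hζ)
        have hgd : DifferentiableAt ℂ g ζ :=
          (hd _ (hLm ζ (ball_subset_closedBall hζ.1)) hζ.2).comp ζ hLd.differentiableAt
        have : DifferentiableAt ℂ (fun ζ : ℂ => ((T : ℂ) / ζ) ^ m) ζ := by
          fun_prop (disch := assumption)
        exact (this.smul hgd).differentiableWithinAt
      · apply ContinuousOn.smul
        · apply ContinuousOn.pow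
          exact continuousOn_const.div continuousOn_id hW0
        · exact hgc.mono hWcl
    have hfr : ∀ z ∈ frontier W, ‖k z‖ ≤ M := by
      intro z hz
      have hzc := hWcl hz.1
      have hM0 : 0 ≤ M := (norm_nonneg _).trans (hM z hzc)
      by_cases hgz : g z = 0
      · simp [k, hgz, hM0]
      · have hzT : ‖z‖ = T := by
          have h1 : ‖z‖ ≤ T := by simpa using hzc
          refine le_antisymm h1 ?_
          by_contra hlt
          have : z ∈ W := ⟨by simpa using lt_of_not_ge hlt, hgz⟩
          rw [hWo.frontier_eq] at hz
          exact hz.2 this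
        simp only [k, norm_smul, norm_pow, norm_div, Complex.norm_real, hzT, Real.norm_eq_abs]
        rw [abs_of_pos (by linarith), div_self (by linarith), one_pow, one_mul]
        exact hM z hzc
    have := Complex.norm_le_of_forall_mem_frontier_norm_le
      (isBounded_ball.subset inter_subset_left) hk hfr (subset_closure h1W)
    simp only [k, div_one, norm_smul, norm_pow, Complex.norm_real, Real.norm_eq_abs] at this
    rw [abs_of_pos (by linarith)] at this
    have hg1 : g 1 = h a := by simp [g, L, hv]
    rw [hg1] at this
    rw [one_div, inv_pow, ← div_eq_mul_inv, le_div_iff₀ (by positivity)]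
    linarith
  have hlim : Tendsto (fun m : ℕ => M * (1 / T) ^ m) atTop (𝓝 (M * 0)) :=
    (tendsto_pow_atTop_nhds_zero_of_lt_one (by positivity)
      ((div_lt_one (by linarith)).2 hT1)).const_mul M
  have := ge_of_tendsto' hlim key
  rw [mul_zero] at this
  exact hne (norm_le_zero_iff.1 this)

theorem identity_thm {E F : Type*} [NormedAddCommGroup E] [NormedSpace ℂ E]
    [NormedAddCommGroup F] [NormedSpace ℂ F] {h : E → F} {D : Set E} (hDo : IsOpen D)
    (hDc : IsPreconnected D) (hd : DifferentiableOn ℂ h D) {q : E} (hq : q ∈ D)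
    (hb : ∀ᶠ x in 𝓝 q, h x = 0) : ∀ x ∈ D, h x = 0 := by
  let u : Set E := {x | ∀ᶠ y in 𝓝 x, h y = 0}
  have hu : IsOpen u := isOpen_setOfPred_eventually_nhds
  have : D ⊆ u := by
    apply hDc.subset_of_closure_inter_subset hu ⟨q, hq, hb⟩
    rintro x ⟨hx, hxD⟩
    obtain ⟨r, hr, hrD⟩ := Metric.isOpen_iff.1 hDo x hxD
    obtain ⟨y, hyu, hxy⟩ := Metric.mem_closure_iff.1 hx (r / 2) (by positivity)
    have hsub : ball y (r / 2) ⊆ D := by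
      intro w hw
      apply hrD
      have := dist_triangle w y x
      rw [dist_comm] at hxy
      simp only [mem_ball] at *
      linarith
    have := rado_ball (h := h) (b := y) (R := r / 2) (hd.continuousOn.mono hsub)
      (fun w hw _ => hd.differentiableAt (hDo.mem_nhds (hsub hw))) hyu
    filter_upwards [isOpen_ball.mem_nhds (show x ∈ ball y (r / 2) from hxy)] with w hw
      using this w hw
  exact fun x hx => (this hx).self_of_nhds

theorem cauchy_fderiv {E F : Type*} [NormedAddCommGroup E] [NormedSpace ℂ E]
    [NormedAddCommGroup F] [NormedSpace ℂ F] {h : E → F} {x : E} {r M : ℝ} (hr : 0 < r)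
    (hd : DifferentiableOn ℂ h (ball x r)) (hM : ∀ y ∈ ball x r, ‖h y‖ ≤ M) :
    ‖fderiv ℂ h x‖ ≤ (2 * M + 1) / r := by
  apply Complex.norm_fderiv_le_div_of_mapsTo_ball hd _ hr
  intro y hy
  have h1 := hM y hy
  have h2 := hM x (mem_ball_self hr)
  rw [mem_closedBall, dist_eq_norm]
  have := norm_sub_le (h y) (h x)
  linarith

theorem holo_integral {α : Type*} [MeasurableSpace α] (μ : Measure α) [IsFiniteMeasure μ]
    {E F : Type*} [NormedAddCommGroup E] [NormedSpace ℂ E] [FiniteDimensional ℂ E]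
    [NormedAddCommGroup F] [NormedSpace ℂ F] [CompleteSpace F]
    {U : Set E} (hU : IsOpen U) {H : E → α → F} {M : ℝ}
    (hmeas : ∀ x ∈ U, AEStronglyMeasurable (H x) μ)
    (hd : ∀ᵐ a ∂μ, DifferentiableOn ℂ (fun x => H x a) U)
    (hM : ∀ᵐ a ∂μ, ∀ x ∈ U, ‖H x a‖ ≤ M) :
    DifferentiableOn ℂ (fun x => ∫ a, H x a ∂μ) U := by
  intro x₀ hx₀
  obtain ⟨r, hr, hrU⟩ := Metric.isOpen_iff.1 hU x₀ hx₀
  have hda : ∀ᵐ a ∂μ, ∀ x ∈ U, HasFDerivAt (fun x => H x a) (fderiv ℂ (fun x => H x a) x) x := by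
    filter_upwards [hd] with a ha x hx
    exact (ha.differentiableAt (hU.mem_nhds hx)).hasFDerivAt
  have hIntegr : Integrable (H x₀) μ := by
    apply Integrable.of_bound (hmeas x₀ hx₀) M
    filter_upwards [hM] with a ha using ha x₀ hx₀
  have hdirm : ∀ v : E, AEStronglyMeasurable (fun a => fderiv ℂ (fun x => H x a) x₀ v) μ := by
    intro v
    -- limit of difference quotients
    have ht : ∀ᶠ k : ℕ in atTop, x₀ + ((k : ℂ))⁻¹ • v ∈ U := by
      have : Tendsto (fun k : ℕ => x₀ + ((k : ℂ))⁻¹ • v) atTop (𝓝 (x₀ + (0 : ℂ) • v)) :=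
        tendsto_const_nhds.add ((tendsto_inv_atTop_nhds_zero_nat (𝕜 := ℂ)).smul_const v)
      rw [zero_smul, add_zero] at this
      exact this.eventually (hU.mem_nhds hx₀)
    obtain ⟨k₀, hk₀⟩ := eventually_atTop.1 ht
    refine aestronglyMeasurable_of_tendsto_ae atTop
      (f := fun (k : ℕ) a => ((k + k₀ : ℕ) : ℂ) • (H (x₀ + (((k + k₀ : ℕ) : ℂ))⁻¹ • v) a - H x₀ a)) ?_ ?_
    · intro k
      exact ((hmeas _ (hk₀ _ (by omega))).sub (hmeas _ hx₀)).const_smul _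
    · filter_upwards [hda] with a ha
      refine (ha x₀ hx₀).lim v (l := atTop) (c := fun k : ℕ => ((k + k₀ : ℕ) : ℂ)) ?_
      simp only [Complex.norm_natCast]
      exact tendsto_natCast_atTop_atTop.comp (tendsto_add_atTop_nat k₀)
  have hF' : AEStronglyMeasurable (fun a => fderiv ℂ (fun x => H x a) x₀) μ := by
    let b := Module.finBasis ℂ E
    have heq : ∀ A : E →L[ℂ] F, A = ∑ i, (LinearMap.toContinuousLinearMap (b.coord i)).smulRight (A (b i)) := by
      intro A
      ext v
      simp only [sum_apply, ContinuousLinearMap.smulRight_apply]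
      conv_lhs => rw [← b.sum_repr v, map_sum]
      simp only [map_smul]
      rfl
    have : (fun a => fderiv ℂ (fun x => H x a) x₀) = fun a => ∑ i,
      (LinearMap.toContinuousLinearMap (b.coord i)).smulRight (fderiv ℂ (fun x => H x a) x₀ (b i)) := by
      funext a
      exact heq _
    rw [this]
    refine Finset.aestronglyMeasurable_fun_sum _ fun i _ => ?_
    have hcont : Continuous (fun w : F =>
      (LinearMap.toContinuousLinearMap (b.coord i)).smulRight w) :=
      (ContinuousLinearMap.smulRightL ℂ E F (LinearMap.toContinuousLinearMap (b.coord i))).continuous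
    exact hcont.comp_aestronglyMeasurable (hdirm (b i))
  refine (hasFDerivAt_integral_of_dominated_of_fderiv_le (𝕜 := ℂ) (s := ball x₀ (r / 2))
    (F' := fun x a => fderiv ℂ (fun x => H x a) x)
    (bound := fun _ => (2 * M + 1) / (r / 2))
    (ball_mem_nhds x₀ (by positivity)) ?_ hIntegr hF' ?_ (integrable_const _) ?_).differentiableAt.differentiableWithinAt
  · filter_upwards [hU.mem_nhds hx₀] with x hx using hmeas x hx
  · filter_upwards [hd, hM] with a ha hMa x hx
    have hsub : ball x (r / 2) ⊆ U := by
      intro w hw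
      apply hrU
      have := dist_triangle w x x₀
      simp only [mem_ball] at *
      linarith
    exact cauchy_fderiv (by positivity) (ha.mono hsub) fun y hy => hMa y (hsub hy)
  · filter_upwards [hda] with a ha x hx
    exact ha x (hrU (ball_subset_ball (by linarith) hx))

theorem fderiv_apply_differentiableOn {E F : Type*} [NormedAddCommGroup E] [NormedSpace ℂ E]
    [FiniteDimensional ℂ E] [NormedAddCommGroup F] [NormedSpace ℂ F] [CompleteSpace F]
    {f : E → F} {U : Set E} (hU : IsOpen U) (hf : DifferentiableOn ℂ f U) (v : E) :
    DifferentiableOn ℂ (fun x => fderiv ℂ f x v) U := by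
  intro x₀ hx₀
  apply DifferentiableAt.differentiableWithinAt
  have : ProperSpace E := FiniteDimensional.proper ℂ E
  obtain ⟨r, hr, hrU⟩ := Metric.isOpen_iff.1 hU x₀ hx₀
  -- a compact ball and a small circle
  obtain ⟨M, hM⟩ : ∃ M, ∀ y ∈ closedBall x₀ (r / 2), ‖f y‖ ≤ M :=
    (isCompact_closedBall _ _).exists_bound_of_continuousOn
      (hf.continuousOn.mono ((closedBall_subset_ball (by linarith)).trans hrU))
  let s : ℝ := r / 4 / (‖v‖ + 1)
  have hs : 0 < s := by positivity
  have hsv : s * ‖v‖ ≤ r / 4 := by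
    simp only [s]
    rw [div_mul_eq_mul_div, div_le_iff₀ (by positivity)]
    nlinarith [norm_nonneg v]
  have hin : ∀ x ∈ ball x₀ (r / 4), ∀ ζ : ℂ, ‖ζ‖ ≤ s → x + ζ • v ∈ ball x₀ (r / 2) := by
    intro x hx ζ hζ
    rw [mem_ball, dist_eq_norm] at *
    have : ‖ζ • v‖ ≤ r / 4 := by
      rw [norm_smul]
      exact (mul_le_mul_of_nonneg_right hζ (norm_nonneg _)).trans hsv
    calc ‖x + ζ • v - x₀‖ = ‖(x - x₀) + ζ • v‖ := by congr 1; abel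
      _ ≤ ‖x - x₀‖ + ‖ζ • v‖ := norm_add_le _ _
      _ < r / 2 := by linarith
  have hbU : ball x₀ (r / 2) ⊆ U := (ball_subset_ball (by linarith)).trans hrU
  have hform : ∀ x ∈ ball x₀ (r / 4), fderiv ℂ f x v =
      (2 * Real.pi * Complex.I : ℂ)⁻¹ • ∫ θ in Ioc 0 (2 * Real.pi),
        (deriv (circleMap 0 s) θ * (circleMap 0 s θ ^ 2)⁻¹) • f (x + circleMap 0 s θ • v) := by
    intro x hx
    let g : ℂ → F := fun ζ => f (x + ζ • v)
    let O : Set ℂ := (fun ζ : ℂ => x + ζ • v) ⁻¹' U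
    have hO : IsOpen O := hU.preimage (by fun_prop)
    have hg : DifferentiableOn ℂ g O :=
      hf.comp (by fun_prop : Differentiable ℂ (fun ζ : ℂ => x + ζ • v)).differentiableOn
        (fun ζ hζ => hζ)
    have hcb : closedBall (0 : ℂ) s ⊆ O := fun ζ hζ => hbU (hin x hx ζ (by simpa using hζ))
    have h1 := Complex.two_pi_I_inv_smul_circleIntegral_sub_sq_inv_smul_of_differentiable
      hO hcb hg (mem_ball_self hs)
    have hxU : x ∈ U := hrU (ball_subset_ball (by linarith) hx)
    have h2 : HasDerivAt g (fderiv ℂ f x v) 0 := by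
      have h3 : HasFDerivAt f (fderiv ℂ f x) (x + (0 : ℂ) • v) := by
        rw [zero_smul, add_zero]
        exact (hf.differentiableAt (hU.mem_nhds hxU)).hasFDerivAt
      have h4 : HasDerivAt (fun ζ : ℂ => x + ζ • v) v 0 := by
        simpa using ((hasDerivAt_id (0 : ℂ)).smul_const v).const_add x
      exact h3.comp_hasDerivAt 0 h4
    rw [← h2.deriv, ← h1, circleIntegral, intervalIntegral.integral_of_le Real.two_pi_pos.le]
    congr 1
    refine integral_congr_ae (Eventually.of_forall fun θ => ?_)
    simp only [g, sub_zero, smul_smul]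
  have hev : (fun x => fderiv ℂ f x v) =ᶠ[𝓝 x₀] fun x =>
      (2 * Real.pi * Complex.I : ℂ)⁻¹ • ∫ θ in Ioc 0 (2 * Real.pi),
        (deriv (circleMap 0 s) θ * (circleMap 0 s θ ^ 2)⁻¹) • f (x + circleMap 0 s θ • v) := by
    filter_upwards [ball_mem_nhds x₀ (show 0 < r / 4 by positivity)] with x hx using hform x hx
  rw [hev.differentiableAt_iff]
  apply DifferentiableAt.const_smul
  have hcn : ∀ θ, ‖circleMap 0 s θ‖ ≤ s := fun θ => by simp [abs_of_pos hs]
  refine (holo_integral (U := ball x₀ (r / 4)) (M := s * (s ^ 2)⁻¹ * M) _ isOpen_ball ?_ ?_ ?_).differentiableAt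
    (ball_mem_nhds x₀ (by positivity))
  · intro x hx
    apply Continuous.aestronglyMeasurable
    apply Continuous.smul
    · have h5 : ∀ θ, circleMap 0 s θ ^ 2 ≠ 0 := fun θ =>
        pow_ne_zero _ (circleMap_ne_center hs.ne')
      simp only [deriv_circleMap]
      have := continuous_circleMap 0 s
      fun_prop (disch := exact h5 _)
    · rw [← continuousOn_univ]
      refine (hf.continuousOn.mono hbU).comp (s := univ) ?_ (fun θ _ => hin x hx _ (hcn θ))
      have := continuous_circleMap 0 s
      fun_prop
  · refine Eventually.of_forall fun θ => ?_
    apply DifferentiableOn.const_smul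
    exact (hf.mono hbU).comp (by fun_prop) fun x hx => hin x hx _ (hcn θ)
  · refine Eventually.of_forall fun θ x hx => ?_
    have h6 := hM _ (ball_subset_closedBall (hin x hx _ (hcn θ)))
    rw [norm_smul]
    have h7 : ‖deriv (circleMap 0 s) θ * (circleMap 0 s θ ^ 2)⁻¹‖ = s * (s ^ 2)⁻¹ := by
      simp [abs_of_pos hs]
    rw [h7]
    gcongr

theorem fderiv_differentiableOn {E F : Type*} [NormedAddCommGroup E] [NormedSpace ℂ E]
    [FiniteDimensional ℂ E] [NormedAddCommGroup F] [NormedSpace ℂ F] [CompleteSpace F]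
    {f : E → F} {U : Set E} (hU : IsOpen U) (hf : DifferentiableOn ℂ f U) :
    DifferentiableOn ℂ (fderiv ℂ f) U := by
  let b := Module.finBasis ℂ E
  have heq : ∀ A : E →L[ℂ] F,
      A = ∑ i, (LinearMap.toContinuousLinearMap (b.coord i)).smulRight (A (b i)) := by
    intro A
    ext v
    simp only [sum_apply, ContinuousLinearMap.smulRight_apply]
    conv_lhs => rw [← b.sum_repr v, map_sum]
    simp only [map_smul]
    rfl
  have : fderiv ℂ f = fun a => ∑ i,
      (LinearMap.toContinuousLinearMap (b.coord i)).smulRight (fderiv ℂ f a (b i)) := by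
    funext a
    exact heq _
  rw [this]
  refine DifferentiableOn.fun_sum fun i _ => ?_
  exact (ContinuousLinearMap.smulRightL ℂ E F
    (LinearMap.toContinuousLinearMap (b.coord i))).differentiable.comp_differentiableOn
      (fderiv_apply_differentiableOn hU hf (b i))

theorem differentiableOn_prod {E ι : Type*} [NormedAddCommGroup E] [NormedSpace ℂ E]
    (s : Finset ι) {g : ι → E → ℂ} {U : Set E} (hg : ∀ i, DifferentiableOn ℂ (g i) U) :
    DifferentiableOn ℂ (fun x => ∏ i ∈ s, g i x) U := by
  classical
  induction s using Finset.induction_on with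
  | empty => simp
  | insert a s ha ih =>
    simp only [Finset.prod_insert ha]
    exact (hg a).mul ih

theorem det_differentiableOn {E : Type*} [NormedAddCommGroup E] [NormedSpace ℂ E]
    [FiniteDimensional ℂ E]
    {f : E → E} {U : Set E} (hU : IsOpen U) (hf : DifferentiableOn ℂ f U) :
    DifferentiableOn ℂ (fun x => (fderiv ℂ f x).det) U := by
  let b := Module.finBasis ℂ E
  have : (fun x => (fderiv ℂ f x).det) = fun x =>
      (LinearMap.toMatrix b b (fderiv ℂ f x : E →ₗ[ℂ] E)).det := by
    funext x
    rw [LinearMap.det_toMatrix]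
  rw [this]
  simp only [Matrix.det_apply]
  refine DifferentiableOn.fun_sum fun σ _ => ?_
  apply DifferentiableOn.const_smul
  refine differentiableOn_prod _ fun i => ?_
  simp only [LinearMap.toMatrix_apply]
  exact (LinearMap.toContinuousLinearMap (b.coord (σ i))).differentiable.comp_differentiableOn
      (fderiv_apply_differentiableOn hU hf (b i))

theorem det_not_eventually_zero {E : Type*} [NormedAddCommGroup E] [NormedSpace ℂ E]
    [FiniteDimensional ℂ E] {F : E → E} {D : Set E} (hDo : IsOpen D) (hDc : IsPreconnected D)
    (hF : DifferentiableOn ℂ F D) (hne : (interior (F '' D)).Nonempty) {q : E} (hq : q ∈ D) :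
    ¬ ∀ᶠ x in 𝓝 q, (fderiv ℂ F x).det = 0 := by
  intro h0
  have hall := identity_thm hDo hDc (det_differentiableOn hDo hF) hq h0
  borelize E
  have : FiniteDimensional ℝ E := FiniteDimensional.complexToReal E
  let μ : Measure E := Measure.addHaar
  have hnull : μ (F '' D) = 0 := by
    apply addHaar_image_eq_zero_of_det_fderivWithin_eq_zero μ
      (f' := fun x => (fderiv ℂ F x).restrictScalars ℝ)
    · intro x hx
      exact ((hF.differentiableAt (hDo.mem_nhds hx)).hasFDerivAt.restrictScalars ℝ).hasFDerivWithinAt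
    · intro x hx
      have h1 := hall x hx
      have h2 : ((fderiv ℂ F x).restrictScalars ℝ).det =
        Algebra.norm ℝ (fderiv ℂ F x).det := LinearMap.det_restrictScalars
      rw [h2, h1, Algebra.norm_zero]
  have hpos : 0 < μ (interior (F '' D)) := isOpen_interior.measure_pos μ hne
  exact hpos.ne' (measure_mono_null interior_subset hnull)

theorem strict_fderiv {E : Type*} [NormedAddCommGroup E] [NormedSpace ℂ E]
    [FiniteDimensional ℂ E] {F : E → E} {D : Set E} (hDo : IsOpen D)
    (hF : DifferentiableOn ℂ F D) {x : E} (hx : x ∈ D) :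
    HasStrictFDerivAt F (fderiv ℂ F x) x := by
  have : CompleteSpace E := FiniteDimensional.complete ℂ E
  apply hasStrictFDerivAt_of_hasFDerivAt_of_continuousAt
  · filter_upwards [hDo.mem_nhds hx] with y hy
    exact (hF.differentiableAt (hDo.mem_nhds hy)).hasFDerivAt
  · exact (fderiv_differentiableOn hDo hF).continuousOn.continuousAt (hDo.mem_nhds hx)

theorem inj_open {E : Type*} [NormedAddCommGroup E] [NormedSpace ℂ E]
    [FiniteDimensional ℂ E] {F : E → E} {D : Set E} (hDo : IsOpen D) (hDc : IsPreconnected D)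
    (hF : DifferentiableOn ℂ F D) (hinj : InjOn F D)
    (hne : (interior (F '' D)).Nonempty) {q : E} (hq : q ∈ D) {N : Set E} (hN : N ∈ 𝓝 q) :
    F '' (N ∩ D) ∈ 𝓝 (F q) := by
  have : CompleteSpace E := FiniteDimensional.complete ℂ E
  have : ProperSpace E := FiniteDimensional.proper ℂ E
  have hJ0 := det_not_eventually_zero hDo hDc hF hne hq
  have hJd := det_differentiableOn hDo hF
  set J : E → ℂ := fun x => (fderiv ℂ F x).det with hJ
  obtain ⟨δ, hδ, hCN⟩ := Metric.nhds_basis_closedBall.mem_iff.1 (inter_mem hN (hDo.mem_nhds hq))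
  set C := closedBall q δ with hC
  have hCD : C ⊆ D := fun x hx => (hCN hx).2
  have hCc : IsCompact C := isCompact_closedBall q δ
  refine mem_of_superset ?_ (image_mono hCN)
  have hFc : ContinuousOn F D := hF.continuousOn
  have hFCc : IsCompact (F '' C) := hCc.image_of_continuousOn (hFc.mono hCD)
  have hFSc : IsCompact (F '' sphere q δ) :=
    (isCompact_sphere q δ).image_of_continuousOn (hFc.mono (sphere_subset_closedBall.trans hCD))
  have hnot : F q ∉ F '' sphere q δ := by
    rintro ⟨y, hy, hyq⟩
    have := hinj (hCD (sphere_subset_closedBall hy)) hq hyq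
    subst this
    simp at hy
    exact hδ.ne hy
  obtain ⟨ε, hε, hεS⟩ := Metric.isOpen_iff.1 hFSc.isClosed.isOpen_compl (F q) hnot
  -- the inverse
  have : Nonempty E := ⟨q⟩
  let G : E → E := Function.invFunOn F C
  have hGF : ∀ x ∈ C, G (F x) = x := fun x hx => (hinj.mono hCD).leftInvOn_invFunOn hx
  have hGC : ∀ w ∈ F '' C, G w ∈ C := fun w hw => Function.invFunOn_mem hw
  have hFG : ∀ w ∈ F '' C, F (G w) = w := fun w hw => Function.invFunOn_eq hw
  have hGball : ∀ w ∈ F '' C, w ∈ ball (F q) ε → G w ∈ ball q δ := by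
    intro w hw hwε
    have h1 := hGC w hw
    rcases (mem_closedBall.1 h1).lt_or_eq with h2 | h2
    · exact h2
    · exact absurd ⟨G w, h2, hFG w hw⟩ (hεS hwε)
  have hGcont : ContinuousOn G (F '' C) := by
    rw [continuousOn_iff_isClosed]
    intro t ht
    refine ⟨F '' (t ∩ C), ((hCc.inter_left ht).image_of_continuousOn
      (hFc.mono (inter_subset_right.trans hCD))).isClosed, ?_⟩
    ext w
    constructor
    · rintro ⟨hw, hwC⟩
      exact ⟨⟨G w, ⟨hw, hGC w hwC⟩, hFG w hwC⟩, hwC⟩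
    · rintro ⟨⟨x, ⟨hxt, hxC⟩, rfl⟩, hwC⟩
      refine ⟨?_, hwC⟩
      rw [mem_preimage, hGF x hxC]
      exact hxt
  classical
  let h : E → ℂ := fun w => if w ∈ F '' C then J (G w) else 0
  have hJc : ContinuousOn J D := hJd.continuousOn
  have hreg : ∀ w ∈ ball (F q) ε, w ∈ F '' C → J (G w) ≠ 0 → DifferentiableAt ℂ h w := by
    intro w hw hwC hJw
    have hx := hGball w hwC hw
    have hxD : G w ∈ D := hCD (hGC w hwC)
    have hst := strict_fderiv hDo hF hxD
    let A := ContinuousLinearMap.toContinuousLinearEquivOfDetNeZero (fderiv ℂ F (G w)) hJw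
    have hA : (A : E →L[ℂ] E) = fderiv ℂ F (G w) := by
      ext v; rfl
    rw [← hA] at hst
    have hmap := hst.map_nhds_eq_of_equiv
    rw [hFG w hwC] at hmap
    have hnb : F '' C ∈ 𝓝 w := by
      rw [← hmap]
      exact image_mem_map (mem_of_superset (isOpen_ball.mem_nhds hx) ball_subset_closedBall)
    have hGat : ContinuousAt G w := hGcont.continuousAt hnb
    have hGd : HasFDerivAt G (A.symm : E →L[ℂ] E) w :=
      HasFDerivAt.of_local_left_inverse hGat hst.hasFDerivAt
        (by filter_upwards [hnb] with y hy using hFG y hy)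
    have hcomp : DifferentiableAt ℂ (fun y => J (G y)) w :=
      (hJd.differentiableAt (hDo.mem_nhds hxD)).comp w hGd.differentiableAt
    refine hcomp.congr_of_eventuallyEq ?_
    filter_upwards [hnb] with y hy
    simp only [h, if_pos hy]
  have hcont : ContinuousOn h (ball (F q) ε) := by
    intro w hw
    apply ContinuousAt.continuousWithinAt
    by_cases hwC : w ∈ F '' C
    · by_cases hJw : J (G w) = 0
      · have hw0 : h w = 0 := by simp only [h, if_pos hwC, hJw]
        rw [ContinuousAt, hw0]
        have hJG : ContinuousWithinAt (fun y => J (G y)) (F '' C) w :=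
          (hJc.comp hGcont fun y hy => hCD (hGC y hy)) w hwC
        rw [← nhdsWithin_univ, ← union_compl_self (F '' C), nhdsWithin_union]
        apply Tendsto.sup
        · have : Tendsto (fun y => J (G y)) (𝓝[F '' C] w) (𝓝 0) := by
            have := hJG.tendsto
            rwa [hJw] at this
          refine this.congr' ?_
          filter_upwards [self_mem_nhdsWithin] with y hy
          simp only [h, if_pos hy]
        · refine tendsto_const_nhds.congr' ?_
          filter_upwards [self_mem_nhdsWithin] with y hy
          exact (if_neg hy).symm
      · exact (hreg w hw hwC hJw).continuousAt
    · have : h =ᶠ[𝓝 w] fun _ => 0 := by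
        filter_upwards [hFCc.isClosed.isOpen_compl.mem_nhds hwC] with y hy
        exact if_neg hy
      exact continuousAt_const.congr this.symm
  have hdiff : ∀ w ∈ ball (F q) ε, h w ≠ 0 → DifferentiableAt ℂ h w := by
    intro w hw hne0
    by_cases hwC : w ∈ F '' C
    · simp only [h, if_pos hwC] at hne0
      exact hreg w hw hwC hne0
    · exact absurd (if_neg hwC) hne0
  refine mem_of_superset (ball_mem_nhds (F q) (show 0 < ε / 4 by positivity)) ?_
  intro b hb
  by_contra hbC
  have hb0 : ∀ᶠ y in 𝓝 b, h y = 0 := by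
    filter_upwards [hFCc.isClosed.isOpen_compl.mem_nhds hbC] with y hy
    exact if_neg hy
  have hsub : ball b (ε / 2) ⊆ ball (F q) ε := by
    intro w hw
    have := dist_triangle w b (F q)
    simp only [mem_ball] at *
    linarith
  have hz := rado_ball (h := h) (hcont.mono hsub) (fun w hw => hdiff w (hsub hw)) hb0
  apply hJ0
  have hFq : ContinuousAt F q := hFc.continuousAt (hDo.mem_nhds hq)
  filter_upwards [hFq (ball_mem_nhds (F q) (show 0 < ε / 4 by positivity)),
    closedBall_mem_nhds q hδ] with x hx hxC
  have h1 : F x ∈ ball b (ε / 2) := by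
    have := dist_triangle (F x) (F q) b
    rw [dist_comm (F q) b] at this
    simp only [mem_ball, mem_preimage] at *
    linarith
  have h2 := hz _ h1
  have h3 : h (F x) = J (G (F x)) := if_pos (mem_image_of_mem F hxC)
  rw [h3, hGF x hxC] at h2
  exact h2

/-- The Wirtinger derivative `∂φ/∂ζ̄`. -/
noncomputable def dbar {F : Type*} [NormedAddCommGroup F] [NormedSpace ℂ F]
    (φ : ℂ → F) (ζ : ℂ) : F :=
  (2 : ℂ)⁻¹ • (fderiv ℝ φ ζ 1 + Complex.I • fderiv ℝ φ ζ Complex.I)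

theorem dbar_eq_exp {F : Type*} [NormedAddCommGroup F] [NormedSpace ℂ F]
    (φ : ℂ → F) (ζ : ℂ) (w : ℂ) (hw : ‖w‖ = 1) :
    w⁻¹ • dbar φ ζ =
      (2 : ℂ)⁻¹ • (fderiv ℝ φ ζ w + Complex.I • fderiv ℝ φ ζ (Complex.I * w)) := by
  have hn : w.re * w.re + w.im * w.im = 1 := by
    have := Complex.normSq_eq_norm_sq w
    rw [hw, Complex.normSq_apply] at this
    linarith
  have hinv : w⁻¹ = (w.re : ℂ) - w.im * Complex.I := by
    rw [Complex.inv_def, Complex.normSq_apply, hn]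
    apply Complex.ext <;> simp
  have h1 : w = w.re • (1 : ℂ) + w.im • Complex.I := by
    apply Complex.ext <;> simp
  have h2 : Complex.I * w = w.re • Complex.I + (-w.im) • (1 : ℂ) := by
    apply Complex.ext <;> simp
  rw [h2, dbar, hinv]
  conv_rhs => rw [h1]
  simp only [map_add, map_smul]
  generalize fderiv ℝ φ ζ 1 = a
  generalize fderiv ℝ φ ζ Complex.I = b
  have h3 : ∀ (t : ℝ) (v : F), t • v = (t : ℂ) • v := fun t v => (Complex.coe_smul t v).symm
  simp only [h3, smul_add, smul_smul, Complex.add_re, Complex.add_im]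
  have hI : Complex.I * Complex.I = -1 := Complex.I_mul_I
  simp only [Complex.real_smul, Complex.mul_re, Complex.mul_im, Complex.I_re, Complex.I_im,
    Complex.ofReal_re, Complex.ofReal_im, Complex.one_re, Complex.one_im]
  match_scalars <;> simp <;> ring_nf <;> simp <;> ring

theorem pompeiu_zero {F : Type*} [NormedAddCommGroup F] [NormedSpace ℂ F] [CompleteSpace F]
    {φ : ℂ → F} (hφ : ContDiff ℝ 1 φ) (hc : HasCompactSupport φ) :
    ∫ ζ, ζ⁻¹ • dbar φ ζ = -(Real.pi : ℂ) • φ 0 := by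
  have hDc : Continuous (fderiv ℝ φ) := hφ.continuous_fderiv (by norm_num)
  have hd : ∀ ζ, HasFDerivAt φ (fderiv ℝ φ ζ) ζ := fun ζ =>
    (hφ.differentiable (by norm_num) ζ).hasFDerivAt
  obtain ⟨R, hR0, hR⟩ : ∃ R : ℝ, 0 < R ∧ ∀ ζ : ℂ, R < ‖ζ‖ → ζ ∉ tsupport φ := by
    obtain ⟨R, hR⟩ := hc.isBounded.subset_closedBall (0 : ℂ)
    refine ⟨max R 1, by positivity, fun ζ hζ hmem => ?_⟩
    have := hR hmem
    simp only [mem_closedBall, dist_zero_right] at this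
    exact absurd (this.trans (le_max_left R 1)) (not_le.2 hζ)
  have hφ0 : ∀ ζ : ℂ, R < ‖ζ‖ → φ ζ = 0 := fun ζ hζ => image_eq_zero_of_notMem_tsupport (hR ζ hζ)
  have hD0 : ∀ ζ : ℂ, R < ‖ζ‖ → fderiv ℝ φ ζ = 0 := fun ζ hζ =>
    image_eq_zero_of_notMem_tsupport (fun h => hR ζ hζ (tsupport_fderiv_subset ℝ h))
  let w : ℝ → ℂ := fun θ => Complex.exp (θ * Complex.I)
  have hwn : ∀ θ, ‖w θ‖ = 1 := fun θ => Complex.norm_exp_ofReal_mul_I θ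
  have hw0 : ∀ θ, w θ ≠ 0 := fun θ => Complex.exp_ne_zero _
  have hwc : Continuous w := by fun_prop
  let A : ℝ × ℝ → F := fun p => fderiv ℝ φ (p.1 * w p.2) (w p.2)
  let B : ℝ × ℝ → F := fun p => fderiv ℝ φ (p.1 * w p.2) (Complex.I * w p.2)
  have hAc : Continuous A := by
    have : Continuous fun p : ℝ × ℝ => fderiv ℝ φ (p.1 * w p.2) := hDc.comp (by fun_prop)
    exact this.clm_apply (by fun_prop)
  have hBc : Continuous B := by
    have : Continuous fun p : ℝ × ℝ => fderiv ℝ φ (p.1 * w p.2) := hDc.comp (by fun_prop)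
    exact this.clm_apply (by fun_prop)
  have hbig : ∀ p : ℝ × ℝ, R < p.1 → R < ‖(p.1 : ℂ) * w p.2‖ := by
    intro p hp
    rw [norm_mul, hwn, mul_one, Complex.norm_real, Real.norm_eq_abs, abs_of_pos (hR0.trans hp)]
    exact hp
  let T : Set (ℝ × ℝ) := Ioi (0 : ℝ) ×ˢ Ioo (-Real.pi) Real.pi
  have hT : MeasurableSet T := measurableSet_Ioi.prod measurableSet_Ioo
  have hIntegr : ∀ g : ℝ × ℝ → F, Continuous g → (∀ p : ℝ × ℝ, R < p.1 → g p = 0) →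
      IntegrableOn g T (volume.prod volume) := by
    intro g hg hg0
    have h1 : IntegrableOn g (Icc (0 : ℝ) R ×ˢ Icc (-Real.pi) Real.pi) (volume.prod volume) :=
      hg.continuousOn.integrableOn_compact (isCompact_Icc.prod isCompact_Icc)
    refine h1.of_forall_sdiff_eq_zero hT ?_
    rintro ⟨r, θ⟩ ⟨⟨hr, hθ⟩, hn⟩
    apply hg0
    by_contra hle
    exact hn ⟨⟨le_of_lt hr, not_lt.1 hle⟩, ⟨hθ.1.le, hθ.2.le⟩⟩
  have hAi := hIntegr A hAc (fun p hp => by simp only [A, hD0 _ (hbig p hp)]; rfl)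
  have hBi := hIntegr B hBc (fun p hp => by simp only [B, hD0 _ (hbig p hp)]; rfl)
  have hpolar : ∫ ζ, ζ⁻¹ • dbar φ ζ =
      ∫ p in T, (2 : ℂ)⁻¹ • (A p + Complex.I • B p) ∂(volume.prod volume) := by
    rw [← Complex.integral_comp_polarCoord_symm]
    change ∫ p in polarCoord.target, _ ∂(volume.prod volume) = _
    rw [polarCoord_target]
    refine setIntegral_congr_fun hT ?_
    rintro ⟨r, θ⟩ ⟨hr, hθ⟩
    have hr' : (0 : ℝ) < r := hr
    have hrc : (r : ℂ) ≠ 0 := by exact_mod_cast hr'.ne'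
    have hs : Complex.polarCoord.symm (r, θ) = r * w θ := by
      rw [Complex.polarCoord_symm_apply]
      simp only [w, Complex.exp_mul_I]
      simp
    simp only [hs, A, B]
    rw [← dbar_eq_exp φ _ (w θ) (hwn θ), ← Complex.coe_smul, smul_smul]
    congr 1
    field_simp
  have hA : ∫ p in T, A p ∂(volume.prod volume) = -(2 * Real.pi : ℂ) • φ 0 := by
    rw [← setIntegral_prod_swap, setIntegral_prod]
    · have : ∀ θ : ℝ, ∫ r in Ioi (0 : ℝ), A (r, θ) = - φ 0 := by
        intro θ
        have hder : ∀ r : ℝ, HasDerivAt (fun r : ℝ => φ (r * w θ)) (A (r, θ)) r := by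
          intro r
          have h1 : HasDerivAt (fun r : ℝ => (r : ℂ) * w θ) (w θ) r := by
            simpa using (Complex.ofRealCLM.hasDerivAt (x := r)).mul_const (w θ)
          exact (hd _).comp_hasDerivAt r h1
        have hi : IntegrableOn (fun r => A (r, θ)) (Ioi (0 : ℝ)) := by
          have h1 : IntegrableOn (fun r => A (r, θ)) (Icc (0 : ℝ) R) :=
            (hAc.comp (by fun_prop : Continuous fun r : ℝ => (r, θ))).continuousOn.integrableOn_compact
              isCompact_Icc
          refine h1.of_forall_sdiff_eq_zero measurableSet_Ioi ?_
          rintro r ⟨hr, hn⟩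
          have : R < r := by
            by_contra hle
            exact hn ⟨le_of_lt hr, not_lt.1 hle⟩
          simp only [A, hD0 _ (hbig (r, θ) this)]
          rfl
        have hlim : Tendsto (fun r : ℝ => φ (r * w θ)) atTop (𝓝 0) := by
          refine tendsto_const_nhds.congr' ?_
          filter_upwards [eventually_gt_atTop R] with r hr
          exact (hφ0 _ (hbig (r, θ) hr)).symm
        have := integral_Ioi_of_hasDerivAt_of_tendsto' (fun r _ => hder r) hi hlim
        simpa using this
      simp only [Prod.swap_prod_mk, this]
      simp only [setIntegral_const, ← Complex.coe_smul, smul_neg, neg_smul]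
      congr 2
      simp [Real.pi_pos.le]
      ring
    · exact hAi.swap
  have hB : ∫ p in T, B p ∂(volume.prod volume) = 0 := by
    rw [setIntegral_prod _ hBi]
    apply setIntegral_eq_zero_of_forall_eq_zero
    intro r hr
    have hr' : (0 : ℝ) < r := hr
    have hder : ∀ θ : ℝ, HasDerivAt (fun θ : ℝ => φ (r * w θ)) (r • B (r, θ)) θ := by
      intro θ
      have h0 : HasDerivAt w (Complex.I * w θ) θ := by
        have h1 : HasDerivAt (fun θ : ℝ => (θ : ℂ) * Complex.I) Complex.I θ := by
          simpa using (Complex.ofRealCLM.hasDerivAt (x := θ)).mul_const Complex.I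
        have := h1.cexp
        rwa [mul_comm] at this
      have h2 : HasDerivAt (fun θ : ℝ => (r : ℂ) * w θ) (r * (Complex.I * w θ)) θ :=
        h0.const_mul (r : ℂ)
      have h3 := (hd _).comp_hasDerivAt θ h2
      have h4 : r • B (r, θ) = (fderiv ℝ φ (r * w θ)) (r * (Complex.I * w θ)) := by
        change r • (fderiv ℝ φ (r * w θ)) (Complex.I * w θ) = _
        rw [← map_smul, Complex.real_smul]
      rw [h4]
      exact h3
    have hBr : Continuous fun θ => r • B (r, θ) :=
      (hBc.comp (by fun_prop : Continuous fun θ : ℝ => (r, θ))).const_smul r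
    have h1 := intervalIntegral.integral_eq_sub_of_hasDerivAt (a := -Real.pi) (b := Real.pi)
      (fun θ _ => hder θ) (hBr.intervalIntegrable _ _)
    have hwpi : w Real.pi = w (-Real.pi) := by
      simp [w, Complex.exp_neg, Complex.exp_pi_mul_I]
    rw [hwpi, sub_self, intervalIntegral.integral_smul, smul_eq_zero,
      intervalIntegral.integral_of_le (by linarith [Real.pi_pos]), integral_Ioc_eq_integral_Ioo] at h1
    exact h1.resolve_left hr'.ne'
  have hA' : Integrable A ((volume.prod volume).restrict T) := hAi
  have hB' : Integrable B ((volume.prod volume).restrict T) := hBi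
  rw [hpolar, integral_smul, integral_add hA' (hB'.fun_smul Complex.I), integral_smul, hA, hB,
    smul_zero, add_zero, smul_smul]
  congr 1
  ring

theorem pompeiu {F : Type*} [NormedAddCommGroup F] [NormedSpace ℂ F] [CompleteSpace F]
    {φ : ℂ → F} (hφ : ContDiff ℝ 1 φ) (hc : HasCompactSupport φ) (z : ℂ) :
    ∫ ζ, (ζ - z)⁻¹ • dbar φ ζ = -(Real.pi : ℂ) • φ z := by
  have h1 := pompeiu_zero (φ := fun ζ => φ (ζ + z)) (hφ.comp (by fun_prop))
    (hc.comp_homeomorph (Homeomorph.addRight z))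
  rw [← integral_add_right_eq_self _ z]
  simp only [zero_add] at h1
  rw [← h1]
  congr 1
  funext ζ
  simp only [dbar, fderiv_comp_add_right, add_sub_cancel_right]

/-- admissible cut-off functions on the slice `y + ℂ e` -/
structure Adm {E : Type*} [NormedAddCommGroup E] [NormedSpace ℂ E] (Ω K : Set E) (e y : E)
    (c : ℂ) (χ : ℂ → ℂ) : Prop where
  smooth : ContDiff ℝ 1 χ
  cpt : HasCompactSupport χ
  om : ∀ ζ ∈ tsupport χ, y + ζ • e ∈ Ω
  one : ∀ ζ, y + ζ • e ∈ K → ∀ᶠ w in 𝓝 ζ, χ w = 1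
  loc : ∀ᶠ w in 𝓝 c, χ w = χ c

theorem dbar_eventually_const {F : Type*} [NormedAddCommGroup F] [NormedSpace ℂ F]
    {φ : ℂ → F} {ζ : ℂ} {a : F} (h : ∀ᶠ w in 𝓝 ζ, φ w = a) : ∀ᶠ w in 𝓝 ζ, dbar φ w = 0 := by
  filter_upwards [h.eventually_nhds] with w hw
  have : φ =ᶠ[𝓝 w] fun _ => a := hw
  simp [dbar, this.fderiv_eq]

theorem dbar_continuous {F : Type*} [NormedAddCommGroup F] [NormedSpace ℂ F]
    {φ : ℂ → F} (h : ContDiff ℝ 1 φ) : Continuous (dbar φ) := by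
  have := h.continuous_fderiv (by norm_num)
  unfold dbar
  fun_prop

theorem dbar_sub {F : Type*} [NormedAddCommGroup F] [NormedSpace ℂ F]
    {φ ψ : ℂ → F} (h : ContDiff ℝ 1 φ) (h' : ContDiff ℝ 1 ψ) (ζ : ℂ) :
    dbar (fun w => φ w - ψ w) ζ = dbar φ ζ - dbar ψ ζ := by
  simp only [dbar]
  rw [fderiv_fun_sub (h.differentiable (by norm_num) ζ) (h'.differentiable (by norm_num) ζ)]
  simp only [ContinuousLinearMap.sub_apply]
  module

theorem dbar_smul_holo {F : Type*} [NormedAddCommGroup F] [NormedSpace ℂ F]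
    {ψ : ℂ → ℂ} {h : ℂ → F} {ζ : ℂ} (hψ : ContDiff ℝ 1 ψ) (hh : DifferentiableAt ℂ h ζ) :
    dbar (fun w => ψ w • h w) ζ = dbar ψ ζ • h ζ := by
  have h1 : HasFDerivAt h ((fderiv ℂ h ζ).restrictScalars ℝ) ζ :=
    hh.hasFDerivAt.restrictScalars ℝ
  have h2 := (hψ.differentiable (by norm_num) ζ).hasFDerivAt.smul h1
  simp only [dbar]
  have h3 : fderiv ℝ (fun w => ψ w • h w) ζ = _ := h2.fderiv
  rw [h3]
  have h4 : (fderiv ℂ h ζ) Complex.I = Complex.I • (fderiv ℂ h ζ) 1 := by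
    rw [← map_smul]; simp
  simp only [ContinuousLinearMap.add_apply, ContinuousLinearMap.smul_apply,
    ContinuousLinearMap.smulRight_apply, ContinuousLinearMap.coe_restrictScalars', h4]
  have h5 : Complex.I • ψ ζ • Complex.I • (fderiv ℂ h ζ) 1 = - ψ ζ • (fderiv ℂ h ζ) 1 := by
    rw [smul_smul, smul_smul]
    congr 1
    linear_combination (ψ ζ) * Complex.I_sq
  rw [smul_add Complex.I, h5]
  simp only [smul_eq_mul]
  module

namespace Adm

variable {E : Type*} [NormedAddCommGroup E] [NormedSpace ℂ E] {F : Type*} [NormedAddCommGroup F]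
  [NormedSpace ℂ F] {Ω K : Set E} {e y : E} {c : ℂ} {χ χ' : ℂ → ℂ} {f : E → F}

theorem compactS (h : Adm Ω K e y c χ) : IsCompact (tsupport (dbar χ)) := by
  apply h.cpt.of_isClosed_subset (isClosed_tsupport _)
  intro ζ hζ
  by_contra hn
  rw [notMem_tsupport_iff_eventuallyEq] at hn
  exact (notMem_tsupport_iff_eventuallyEq.2 (dbar_eventually_const hn)) hζ

theorem memS (h : Adm Ω K e y c χ) {ζ : ℂ} (hζ : ζ ∈ tsupport (dbar χ)) :
    ζ ≠ c ∧ y + ζ • e ∈ Ω \ K := by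
  refine ⟨?_, h.om ζ ?_, ?_⟩
  · rintro rfl
    exact (notMem_tsupport_iff_eventuallyEq.2 (dbar_eventually_const h.loc)) hζ
  · by_contra hn
    rw [notMem_tsupport_iff_eventuallyEq] at hn
    exact (notMem_tsupport_iff_eventuallyEq.2 (dbar_eventually_const hn)) hζ
  · intro hk
    exact (notMem_tsupport_iff_eventuallyEq.2 (dbar_eventually_const (h.one ζ hk))) hζ

theorem integrable (h : Adm Ω K e y c χ) (hD : IsOpen (Ω \ K)) (hf : DifferentiableOn ℂ f (Ω \ K)) :
    Integrable (fun ζ => (ζ - c)⁻¹ • dbar χ ζ • f (y + ζ • e)) := by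
  apply Continuous.integrable_of_hasCompactSupport
  · rw [continuous_iff_continuousAt]
    intro ζ
    by_cases hζ : ζ ∈ tsupport (dbar χ)
    · obtain ⟨h1, h2⟩ := h.memS hζ
      have h3 : ContinuousAt f (y + ζ • e) := (hf.differentiableAt (hD.mem_nhds h2)).continuousAt
      have h4 : ContinuousAt (fun ζ : ℂ => f (y + ζ • e)) ζ :=
        ContinuousAt.comp (f := fun ζ : ℂ => y + ζ • e) h3 (by fun_prop)
      have h5 := (dbar_continuous h.smooth).continuousAt (x := ζ)
      have h6 : ContinuousAt (fun ζ : ℂ => (ζ - c)⁻¹) ζ :=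
        ContinuousAt.inv₀ (by fun_prop) (sub_ne_zero.2 h1)
      exact h6.smul (h5.smul h4)
    · have h0 : (fun ζ => (ζ - c)⁻¹ • dbar χ ζ • f (y + ζ • e)) =ᶠ[𝓝 ζ] fun _ => 0 := by
        filter_upwards [notMem_tsupport_iff_eventuallyEq.1 hζ] with w hw
        simp [hw]
      exact continuousAt_const.congr h0.symm
  · refine HasCompactSupport.intro h.compactS fun ζ hζ => ?_
    simp [image_eq_zero_of_notMem_tsupport hζ]

theorem indep [CompleteSpace F] (h : Adm Ω K e y c χ) (h' : Adm Ω K e y c χ') (hD : IsOpen (Ω \ K))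
    (hf : DifferentiableOn ℂ f (Ω \ K)) :
    (1 - χ c) • f (y + c • e) - (Real.pi : ℂ)⁻¹ • ∫ ζ, (ζ - c)⁻¹ • dbar χ ζ • f (y + ζ • e) =
    (1 - χ' c) • f (y + c • e) - (Real.pi : ℂ)⁻¹ • ∫ ζ, (ζ - c)⁻¹ • dbar χ' ζ • f (y + ζ • e) := by
  set ψ : ℂ → ℂ := fun w => χ w - χ' w with hψ
  have hψs : ContDiff ℝ 1 ψ := h.smooth.sub h'.smooth
  have hψc : HasCompactSupport ψ := h.cpt.sub h'.cpt
  have hcase : ∀ ζ, y + ζ • e ∈ Ω \ K ∨ ∀ᶠ w in 𝓝 ζ, ψ w = 0 := by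
    intro ζ
    by_cases hk : y + ζ • e ∈ K
    · right
      filter_upwards [h.one ζ hk, h'.one ζ hk] with w h1 h2
      simp [hψ, h1, h2]
    by_cases ho : y + ζ • e ∈ Ω
    · exact Or.inl ⟨ho, hk⟩
    · right
      have h1 : ζ ∉ tsupport χ := fun hh => ho (h.om _ hh)
      have h2 : ζ ∉ tsupport χ' := fun hh => ho (h'.om _ hh)
      filter_upwards [notMem_tsupport_iff_eventuallyEq.1 h1,
        notMem_tsupport_iff_eventuallyEq.1 h2] with w h1 h2
      simp [hψ, h1, h2]
  have hO : IsOpen {ζ : ℂ | y + ζ • e ∈ Ω \ K} := hD.preimage (by fun_prop)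
  have hfd : DifferentiableOn ℂ (fun ζ : ℂ => f (y + ζ • e)) {ζ : ℂ | y + ζ • e ∈ Ω \ K} :=
    hf.comp (by fun_prop) fun ζ hζ => hζ
  have hφ : ContDiff ℝ 1 (fun ζ => ψ ζ • f (y + ζ • e)) := by
    rw [contDiff_iff_contDiffAt]
    intro ζ
    rcases hcase ζ with hζ | hζ
    · have h1 : ContDiffAt ℂ 1 (fun ζ : ℂ => f (y + ζ • e)) ζ :=
        ((hfd.analyticAt (hO.mem_nhds hζ))).contDiffAt
      exact hψs.contDiffAt.smul (h1.restrict_scalars ℝ)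
    · refine (contDiffAt_const (c := (0 : F))).congr_of_eventuallyEq ?_
      filter_upwards [hζ] with w hw
      simp [hw]
  have hφc : HasCompactSupport (fun ζ => ψ ζ • f (y + ζ • e)) := hψc.smul_right
  have hdb : ∀ ζ, dbar (fun ζ => ψ ζ • f (y + ζ • e)) ζ =
      dbar χ ζ • f (y + ζ • e) - dbar χ' ζ • f (y + ζ • e) := by
    intro ζ
    rw [← sub_smul, ← dbar_sub h.smooth h'.smooth]
    rcases hcase ζ with hζ | hζ
    · exact dbar_smul_holo hψs (hfd.differentiableAt (hO.mem_nhds hζ))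
    · have h1 : ∀ᶠ w in 𝓝 ζ, ψ w • f (y + w • e) = 0 := by
        filter_upwards [hζ] with w hw
        simp [hw]
      rw [(dbar_eventually_const h1).self_of_nhds, (dbar_eventually_const hζ).self_of_nhds,
        zero_smul]
  have hp := pompeiu hφ hφc c
  simp only [hdb, smul_sub] at hp
  rw [integral_sub (h.integrable hD hf) (h'.integrable hD hf), sub_eq_iff_eq_add] at hp
  rw [hp]
  have hpi : (Real.pi : ℂ) ≠ 0 := by exact_mod_cast Real.pi_ne_zero
  rw [smul_add, smul_smul, ]
  have : (Real.pi : ℂ)⁻¹ * (-(Real.pi : ℂ)) = -1 := by field_simp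
  rw [this]
  simp only [hψ]
  module

end Adm

namespace Adm
variable {E : Type*} [NormedAddCommGroup E] [NormedSpace ℂ E] {F : Type*} [NormedAddCommGroup F]
  [NormedSpace ℂ F] {Ω K : Set E} {e : E} {χ : ℂ → ℂ} {f : E → F} {P : E →L[ℂ] E} {ℓ : E →L[ℂ] ℂ}

theorem eventually (hΩ : IsOpen Ω) (hK : IsCompact K) (hP : ∀ x, P x + ℓ x • e = x) (he : ℓ e = 1)
    {x₀ : E} (h : Adm Ω K e (P x₀) (ℓ x₀) χ) :
    ∀ᶠ x in 𝓝 x₀, Adm Ω K e (P x) (ℓ x) χ ∧ χ (ℓ x) = χ (ℓ x₀) := by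
  have hℓP : ∀ x, ℓ (P x) = 0 := by
    intro x
    have := congrArg ℓ (hP x)
    simpa [he] using this
  have hPe : P e = 0 := by
    have := hP e
    simpa [he] using this
  have hPP : ∀ x, P (P x) = P x := by
    intro x
    have := hP (P x)
    simpa [hℓP] using this
  have h1 : ∀ᶠ x in 𝓝 x₀, ∀ ζ ∈ tsupport χ, P x + ζ • e ∈ Ω := by
    apply h.cpt.eventually_forall_of_forall_eventually
    intro ζ hζ
    have hc : Continuous fun z : E × ℂ => P z.1 + z.2 • e := by fun_prop
    exact hc.continuousAt.eventually (hΩ.mem_nhds (h.om ζ hζ))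
  have h2 : ∀ᶠ x in 𝓝 x₀, ∀ ζ, P x + ζ • e ∈ K → ∀ᶠ w in 𝓝 ζ, χ w = 1 := by
    set O : Set ℂ := {ζ | ∀ᶠ w in 𝓝 ζ, χ w = 1}
    have hO : IsOpen O := isOpen_setOf_eventually_nhds
    have hA : IsCompact (K ∩ ℓ ⁻¹' Oᶜ) := hK.inter_right (hO.isClosed_compl.preimage ℓ.continuous)
    have hPA : IsClosed (P '' (K ∩ ℓ ⁻¹' Oᶜ)) := (hA.image P.continuous).isClosed
    have hx0 : P x₀ ∉ P '' (K ∩ ℓ ⁻¹' Oᶜ) := by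
      rintro ⟨k, ⟨hk, hkO⟩, hkP⟩
      apply hkO
      apply h.one
      rw [← hkP, hP]
      exact hk
    filter_upwards [P.continuous.continuousAt.eventually (hPA.isOpen_compl.mem_nhds hx0)] with x hx ζ hζ
    by_contra hn
    apply hx
    refine ⟨P x + ζ • e, ⟨hζ, ?_⟩, ?_⟩
    · have hn2 : ζ ∉ O := hn
      simpa [hℓP, he] using hn2
    · simp [hPP, hPe]
  have h3 := ℓ.continuous.continuousAt.eventually h.loc.eventually_nhds
  filter_upwards [h1, h2, h3] with x h1 h2 h3
  refine ⟨⟨h.smooth, h.cpt, h1, h2, ?_⟩, h3.self_of_nhds⟩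
  rw [h3.self_of_nhds]
  exact h3

theorem exist (hΩ : IsOpen Ω) (hK : IsCompact K) (hKΩ : K ⊆ Ω)
    (hP : ∀ x, P x + ℓ x • e = x) (he : ℓ e = 1) {x₀ : E} (hx₀ : x₀ ∈ Ω) :
    ∃ χ, Adm Ω K e (P x₀) (ℓ x₀) χ := by
  have hℓP : ∀ x, ℓ (P x) = 0 := by
    intro x
    have := congrArg ℓ (hP x)
    simpa [he] using this
  have hcont : Continuous fun ζ : ℂ => P x₀ + ζ • e := by fun_prop
  have hs : IsCompact {ζ : ℂ | P x₀ + ζ • e ∈ K} := by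
    refine (hK.image ℓ.continuous).of_isClosed_subset (hK.isClosed.preimage hcont) ?_
    intro ζ hζ
    exact ⟨_, hζ, by simp [hℓP, he]⟩
  obtain ⟨T, hTo, hsT, hTΩ, hTx⟩ : ∃ T : Set ℂ, IsOpen T ∧ {ζ : ℂ | P x₀ + ζ • e ∈ K} ⊆ T ∧
      (∀ ζ ∈ T, P x₀ + ζ • e ∈ Ω) ∧ (x₀ ∉ K → ℓ x₀ ∉ T) := by
    by_cases hk : x₀ ∈ K
    · exact ⟨{ζ | P x₀ + ζ • e ∈ Ω}, hΩ.preimage hcont, fun ζ hζ => hKΩ hζ, fun ζ hζ => hζ,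
        fun h => (h hk).elim⟩
    · refine ⟨{ζ | P x₀ + ζ • e ∈ Ω} ∩ {ℓ x₀}ᶜ, (hΩ.preimage hcont).inter isOpen_compl_singleton,
        fun ζ hζ => ⟨hKΩ hζ, ?_⟩, fun ζ hζ => hζ.1, fun _ h => h.2 rfl⟩
      rintro rfl
      apply hk
      have : P x₀ + ℓ x₀ • e ∈ K := hζ
      rwa [hP] at this
  obtain ⟨L, hL, hsL, hLT⟩ := exists_compact_between hs hTo hsT
  obtain ⟨g, hg1, hg0, -⟩ := exists_contMDiffMap_one_nhds_of_subset_interior (n := 1)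
    (modelWithCornersSelf ℝ ℂ) hs.isClosed hsL
  have hg : ContDiff ℝ 1 g := g.contMDiff.contDiff
  have hsupp : tsupport (fun ζ => ((g ζ : ℝ) : ℂ)) ⊆ L := by
    apply closure_minimal _ hL.isClosed
    intro ζ hζ
    by_contra hn
    exact hζ (by simp [hg0 ζ hn])
  have hone : ∀ ζ, P x₀ + ζ • e ∈ K → ∀ᶠ w in 𝓝 ζ, ((g w : ℝ) : ℂ) = 1 := by
    intro ζ hζ
    filter_upwards [(eventually_nhdsSet_iff_forall.1 hg1) ζ hζ] with w hw
    simp [hw]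
  refine ⟨fun ζ => ((g ζ : ℝ) : ℂ), Complex.ofRealCLM.contDiff.comp hg,
    hL.of_isClosed_subset (isClosed_tsupport _) hsupp, fun ζ hζ => hTΩ _ (hLT (hsupp hζ)), hone, ?_⟩
  by_cases hk : x₀ ∈ K
  · have h1 := hone (ℓ x₀) (by rwa [hP])
    rw [h1.self_of_nhds]
    exact h1
  · have h1 : ℓ x₀ ∉ tsupport (fun ζ => ((g ζ : ℝ) : ℂ)) := fun h => hTx hk (hLT (hsupp h))
    have h2 := notMem_tsupport_iff_eventuallyEq.1 h1
    rw [image_eq_zero_of_notMem_tsupport h1]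
    exact h2

theorem diff [FiniteDimensional ℂ E] [CompleteSpace F] (hΩ : IsOpen Ω) (hK : IsCompact K)
    (hP : ∀ x, P x + ℓ x • e = x) (he : ℓ e = 1)
    (hf : DifferentiableOn ℂ f (Ω \ K))
    {x₀ : E} (hx₀ : x₀ ∈ Ω) (h : Adm Ω K e (P x₀) (ℓ x₀) χ) :
    DifferentiableAt ℂ (fun x => (1 - χ (ℓ x)) • f x -
      (Real.pi : ℂ)⁻¹ • ∫ ζ, (ζ - ℓ x)⁻¹ • dbar χ ζ • f (P x + ζ • e)) x₀ := by
  have hD : IsOpen (Ω \ K) := hΩ.sdiff hK.isClosed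
  have hev := h.eventually hΩ hK hP he
  apply DifferentiableAt.sub
  · by_cases hk : x₀ ∈ K
    · have h1 := h.one (ℓ x₀) (by rwa [hP])
      have h2 : (fun x => (1 - χ (ℓ x)) • f x) =ᶠ[𝓝 x₀] fun _ => 0 := by
        filter_upwards [hev] with x hx
        simp [hx.2, h1.self_of_nhds]
      exact (differentiableAt_const _).congr_of_eventuallyEq h2
    · have h2 : (fun x => (1 - χ (ℓ x)) • f x) =ᶠ[𝓝 x₀] fun x => (1 - χ (ℓ x₀)) • f x := by
        filter_upwards [hev] with x hx
        simp [hx.2]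
      exact ((hf.differentiableAt (hD.mem_nhds ⟨hx₀, hk⟩)).const_smul _).congr_of_eventuallyEq h2
  · apply DifferentiableAt.const_smul
    set S := tsupport (dbar χ) with hS
    have hSc : IsCompact S := h.compactS
    set H : E → ℂ → F := fun x ζ => (ζ - ℓ x)⁻¹ • dbar χ ζ • f (P x + ζ • e) with hH
    have hev2 : ∀ᶠ x in 𝓝 x₀, ∀ ζ ∈ S, ζ ≠ ℓ x ∧ P x + ζ • e ∈ Ω \ K := by
      filter_upwards [hev] with x hx ζ hζ
      exact hx.1.memS hζ
    obtain ⟨r, hr, hrS⟩ := Metric.eventually_nhds_iff_ball.1 hev2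
    have hcp : ∀ x ∈ ball x₀ r, ∀ ζ ∈ S, ContinuousAt (fun z : E × ℂ => H z.1 z.2) (x, ζ) := by
      intro x hx ζ hζ
      obtain ⟨h1, h2⟩ := hrS x hx ζ hζ
      have h3 : ContinuousAt f (P x + ζ • e) := (hf.differentiableAt (hD.mem_nhds h2)).continuousAt
      have h4 : ContinuousAt (fun z : E × ℂ => f (P z.1 + z.2 • e)) (x, ζ) :=
        ContinuousAt.comp (f := fun z : E × ℂ => P z.1 + z.2 • e) h3 (by fun_prop)
      have h5 : ContinuousAt (fun z : E × ℂ => dbar χ z.2) (x, ζ) :=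
        ((dbar_continuous h.smooth).comp continuous_snd).continuousAt
      have h6 : ContinuousAt (fun z : E × ℂ => (z.2 - ℓ z.1)⁻¹) (x, ζ) :=
        ContinuousAt.inv₀ (by fun_prop) (sub_ne_zero.2 h1)
      exact h6.smul (h5.smul h4)
    have : ProperSpace E := FiniteDimensional.proper ℂ E
    obtain ⟨M, hM⟩ := ((isCompact_closedBall x₀ (r / 2)).prod hSc).exists_bound_of_continuousOn
      (f := fun z : E × ℂ => H z.1 z.2) (fun z hz => (hcp z.1
        (closedBall_subset_ball (by linarith) hz.1) z.2 hz.2).continuousWithinAt)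
    have : IsFiniteMeasure (volume.restrict S : Measure ℂ) := ⟨by simpa using hSc.measure_lt_top⟩
    have hsub : ball x₀ (r / 2) ⊆ ball x₀ r := ball_subset_ball (by linarith)
    have key := holo_integral (volume.restrict S : Measure ℂ) (U := ball x₀ (r / 2)) isOpen_ball
      (H := H) (M := M) ?_ ?_ ?_
    · have h7 : (fun x => ∫ ζ, H x ζ) = fun x => ∫ ζ in S, H x ζ := by
        funext x
        symm
        apply setIntegral_eq_integral_of_forall_compl_eq_zero
        intro ζ hζ
        simp [hH, image_eq_zero_of_notMem_tsupport hζ]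
      change DifferentiableAt ℂ (fun x => ∫ ζ, H x ζ) x₀
      rw [h7]
      exact key.differentiableAt (ball_mem_nhds _ (by linarith))
    · intro x hx
      apply ContinuousOn.aestronglyMeasurable _ hSc.measurableSet
      intro ζ hζ
      exact (ContinuousAt.comp (f := fun ζ : ℂ => (x, ζ)) (hcp x (hsub hx) ζ hζ)
        (by fun_prop)).continuousWithinAt
    · filter_upwards [ae_restrict_mem hSc.measurableSet] with ζ hζ x hx
      obtain ⟨h1, h2⟩ := hrS x (hsub hx) ζ hζ
      have h3 := hf.differentiableAt (hD.mem_nhds h2)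
      have h4 : DifferentiableAt ℂ (fun x => f (P x + ζ • e)) x :=
        DifferentiableAt.comp (f := fun x => P x + ζ • e) x h3 (by fun_prop)
      have h6 : DifferentiableAt ℂ (fun x => (ζ - ℓ x)⁻¹) x :=
        DifferentiableAt.fun_inv (by fun_prop) (sub_ne_zero.2 h1)
      exact (h6.fun_smul (h4.const_smul _)).differentiableWithinAt
    · filter_upwards [ae_restrict_mem hSc.measurableSet] with ζ hζ x hx
      exact hM (x, ζ) ⟨ball_subset_closedBall hx, hζ⟩

end Adm

theorem hartogs {E : Type*} [NormedAddCommGroup E] [NormedSpace ℂ E] [FiniteDimensional ℂ E]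
    {F : Type*} [NormedAddCommGroup F] [NormedSpace ℂ F] [CompleteSpace F]
    {Ω K : Set E} (hΩ : IsOpen Ω) (hK : IsCompact K) (hKne : K.Nonempty) (hKΩ : K ⊆ Ω)
    (hc : IsPreconnected (Ω \ K)) {ℓ m : E →L[ℂ] ℂ} {e u : E} (he : ℓ e = 1) (hme : m e = 0)
    (hu : m u = 1) {f : E → F} (hf : DifferentiableOn ℂ f (Ω \ K)) :
    ∃ g : E → F, DifferentiableOn ℂ g Ω ∧ EqOn g f (Ω \ K) := by
  classical
  set P : E →L[ℂ] E := ContinuousLinearMap.id ℂ E - ℓ.smulRight e with hPdef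
  have hP : ∀ x, P x + ℓ x • e = x := by intro x; simp [hPdef]
  have hD : IsOpen (Ω \ K) := hΩ.sdiff hK.isClosed
  have hmP : ∀ x, m (P x) = m x := by intro x; simp [hPdef, hme]
  have hex : ∀ x : E, ∃ χ, x ∈ Ω → Adm Ω K e (P x) (ℓ x) χ := by
    intro x
    by_cases hx : x ∈ Ω
    · obtain ⟨χ, h⟩ := Adm.exist hΩ hK hKΩ hP he hx
      exact ⟨χ, fun _ => h⟩
    · exact ⟨0, fun h => (hx h).elim⟩
  choose X hX using hex
  set V : (ℂ → ℂ) → E → F := fun χ x => (1 - χ (ℓ x)) • f x -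
      (Real.pi : ℂ)⁻¹ • ∫ ζ, (ζ - ℓ x)⁻¹ • dbar χ ζ • f (P x + ζ • e) with hV
  have hind : ∀ x ∈ Ω, ∀ χ, Adm Ω K e (P x) (ℓ x) χ → V (X x) x = V χ x := by
    intro x hx χ h
    have := (hX x hx).indep h hD hf
    simpa only [hP] using this
  have hgd : DifferentiableOn ℂ (fun x => V (X x) x) Ω := by
    intro x₀ hx₀
    apply DifferentiableAt.differentiableWithinAt
    refine ((hX x₀ hx₀).diff hΩ hK hP he hf hx₀).congr_of_eventuallyEq ?_
    filter_upwards [(hX x₀ hx₀).eventually hΩ hK hP he, hΩ.mem_nhds hx₀] with x hx hxΩ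
    exact hind x hxΩ _ hx.1
  refine ⟨fun x => V (X x) x, hgd, ?_⟩
  obtain ⟨k, hk, hmax⟩ := hK.exists_isMaxOn hKne
    (f := fun x => (m x).re) (by fun_prop)
  have hbig : ∀ x ∈ Ω, (m k).re < (m x).re → V (X x) x = f x := by
    intro x hx hlt
    have h0 : Adm Ω K e (P x) (ℓ x) (fun _ => 0) := by
      refine ⟨contDiff_const, HasCompactSupport.zero, ?_, ?_, by simp⟩
      · intro ζ hζ
        simp [tsupport] at hζ
      · intro ζ hζ
        have h1 := hmax hζ
        simp [hmP, hme] at h1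
        linarith
    rw [hind x hx _ h0]
    have : ∀ ζ, dbar (fun _ : ℂ => (0 : ℂ)) ζ = 0 := by intro ζ; simp [dbar]
    simp [hV, this]
  obtain ⟨t, ht, htΩ⟩ : ∃ t : ℝ, 0 < t ∧ k + (t : ℂ) • u ∈ Ω := by
    have hcont : Continuous fun t : ℝ => k + (t : ℂ) • u := by fun_prop
    have h1 : ∀ᶠ t : ℝ in 𝓝 0, k + (t : ℂ) • u ∈ Ω :=
      hcont.continuousAt.eventually (hΩ.mem_nhds (by simpa using hKΩ hk))
    have h2 : ∀ᶠ t : ℝ in 𝓝[>] 0, k + (t : ℂ) • u ∈ Ω := h1.filter_mono nhdsWithin_le_nhds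
    obtain ⟨t, h3, h4⟩ := (h2.and self_mem_nhdsWithin).exists
    exact ⟨t, h4, h3⟩
  have hlt : (m k).re < (m (k + (t : ℂ) • u)).re := by simp [hu, ht]
  have hnk : k + (t : ℂ) • u ∉ K := fun h => absurd (hmax h) (not_le.2 hlt)
  have hid := identity_thm hD hc ((hgd.mono diff_subset).sub hf) (q := k + (t : ℂ) • u) ⟨htΩ, hnk⟩ ?_
  · intro x hx
    exact sub_eq_zero.1 (hid x hx)
  · have hopen : IsOpen {x | (m k).re < (m x).re} :=
      isOpen_lt continuous_const (by fun_prop)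
    filter_upwards [hΩ.mem_nhds htΩ, hopen.mem_nhds hlt] with x h1 h2
    simp only [Pi.sub_apply]
    exact sub_eq_zero.2 (hbig x h1 h2)

theorem mem_closure_of_preconnected {E : Type*} [TopologicalSpace E] {V D : Set E}
    (hV : IsPreconnected V) (hD : IsOpen D) (hne : (V ∩ D).Nonempty) {p : E} (hp : p ∈ V)
    (hpD : p ∉ D) : ∃ x ∈ V, x ∈ closure D ∧ x ∉ D := by
  by_contra! hcon
  exact hpD (hV.subset_of_closure_inter_subset hD hne (fun x hx => hcon x hx.2 hx.1) hp)

theorem ext_bound {E : Type*} [NormedAddCommGroup E] [NormedSpace ℂ E] [FiniteDimensional ℂ E]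
    [Nontrivial E]
    {F : Type*} [NormedAddCommGroup F] [NormedSpace ℂ F]
    {Ω K : Set E} (hΩ : IsOpen Ω) (hK : IsCompact K) (hKΩ : K ⊆ Ω) {g : E → F}
    (hg : DifferentiableOn ℂ g Ω) (hb : ∀ x ∈ Ω \ K, ‖g x‖ ≤ 1) : ∀ x ∈ Ω, ‖g x‖ ≤ 1 := by
  intro x hx
  by_cases hk : x ∈ K
  · have : ProperSpace E := FiniteDimensional.proper ℂ E
    obtain ⟨L, hL, hKL, hLΩ⟩ := exists_compact_between hK hΩ hKΩ
    have hcl : closure (interior L) ⊆ L := closure_minimal interior_subset hL.isClosed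
    refine Complex.norm_le_of_forall_mem_frontier_norm_le (U := interior L)
      (hL.isBounded.subset interior_subset) ?_ ?_ (subset_closure (hKL hk))
    · exact (hg.mono (hcl.trans hLΩ)).diffContOnCl
    · intro z hz
      have h1 : z ∈ closure (interior L) := frontier_subset_closure hz
      refine hb z ⟨hLΩ (hcl h1), fun hzk => ?_⟩
      rw [isOpen_interior.frontier_eq] at hz
      exact hz.2 (hKL hzk)
  · exact hb x ⟨hx, hk⟩

theorem key_bound {E : Type*} [NormedAddCommGroup E] [NormedSpace ℂ E] [FiniteDimensional ℂ E]
    [Nontrivial E] {Ω K : Set E} (hΩ : IsOpen Ω) (hK : IsCompact K) (hKne : K.Nonempty)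
    (hKΩ : K ⊆ Ω) (hc : IsPreconnected (Ω \ K)) {ℓ m : E →L[ℂ] ℂ} {e u : E} (he : ℓ e = 1)
    (hme : m e = 0) (hu : m u = 1) {p : E} (hp : p ∈ K) {ρ : ℝ} (hρ : 0 < ρ)
    (hρΩ : ball p ρ ⊆ Ω) {z : E} (hz : z ∈ Ω \ K) (hzp : dist z p < ρ / 2) {r : ℝ} (hr : 0 < r)
    {F : E → E} (hF : DifferentiableOn ℂ F (Ω \ K)) (hinj : InjOn F (Ω \ K))
    (hmaps : MapsTo F (Ω \ K) (ball 0 1)) (hFz : F z = 0) (hball : ball 0 r ⊆ F '' (Ω \ K)) :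
    r ≤ 2 / ρ * dist z p := by
  have hD : IsOpen (Ω \ K) := hΩ.sdiff hK.isClosed
  have : CompleteSpace E := FiniteDimensional.complete ℂ E
  obtain ⟨g, hg, hgF⟩ := hartogs hΩ hK hKne hKΩ hc he hme hu hF
  have hg1 : ∀ x ∈ Ω, ‖g x‖ ≤ 1 := by
    apply ext_bound hΩ hK hKΩ hg
    intro x hx
    rw [hgF hx]
    exact (mem_ball_zero_iff.1 (hmaps hx)).le
  have hgz : g z = 0 := by rw [hgF hz, hFz]
  have hsub : ball z (ρ / 2) ⊆ Ω := by
    refine Subset.trans ?_ hρΩ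
    apply ball_subset_ball'
    linarith
  have hlip : ∀ x ∈ ball z (ρ / 2), ‖g x‖ ≤ 2 / ρ * dist x z := by
    intro x hx
    have := Complex.dist_le_div_mul_dist_of_mapsTo_ball (hg.mono hsub) (R₂ := 1)
      (fun y hy => by rw [hgz]; exact mem_closedBall_zero_iff.2 (hg1 y (hsub hy))) hx
    rw [hgz, dist_zero_right] at this
    convert this using 2
    field_simp
  by_contra! hlt
  set R := min (ρ / 2) (r * ρ / 2) with hR
  have hRpos : 0 < R := by positivity
  have hpR : p ∈ ball z R := by
    rw [mem_ball', hR, lt_min_iff]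
    refine ⟨hzp, ?_⟩
    rw [div_mul_eq_mul_div, div_lt_iff₀ hρ] at hlt
    linarith
  have hRsub : ball z R ⊆ ball z (ρ / 2) := ball_subset_ball (min_le_left _ _)
  have hgr : ∀ x ∈ ball z R, g x ∈ ball (0 : E) r := by
    intro x hx
    rw [mem_ball_zero_iff]
    refine (hlip x (hRsub hx)).trans_lt ?_
    have h1 : dist x z < r * ρ / 2 := lt_of_lt_of_le hx (min_le_right _ _)
    rw [div_mul_eq_mul_div, div_lt_iff₀ hρ]
    linarith
  obtain ⟨x₀, hx₀, hx₀c, hx₀D⟩ := mem_closure_of_preconnected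
    ((convex_ball z R).isPreconnected) hD ⟨z, mem_ball_self hRpos, hz⟩ hpR (fun h => h.2 hp)
  obtain ⟨q, hq, hqF⟩ := hball (hgr x₀ hx₀)
  have hne : q ≠ x₀ := by
    rintro rfl
    exact hx₀D hq
  obtain ⟨N, N', hN, hN', hNN, hNN', hdisj⟩ := t2_separation hne
  have hIntegr : (interior (F '' (Ω \ K))).Nonempty :=
    ⟨0, interior_mono hball (by rw [isOpen_ball.interior_eq]; exact mem_ball_self hr)⟩
  have hopen := inj_open hD hc hF hinj hIntegr hq (hN.mem_nhds hNN)
  rw [hqF] at hopen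
  have hx₀Ω : x₀ ∈ Ω := hsub (hRsub hx₀)
  have hgc : ContinuousAt g x₀ := (hg.differentiableAt (hΩ.mem_nhds hx₀Ω)).continuousAt
  have hev := (hgc hopen)
  obtain ⟨x, ⟨hx1, hx2⟩, hx3⟩ := mem_closure_iff_nhds.1 hx₀c _
    (inter_mem hev (hN'.mem_nhds hNN'))
  obtain ⟨y, ⟨hy1, hy2⟩, hy3⟩ := hx1
  rw [hgF hx3] at hy3
  have := hinj hy2 hx3 hy3
  subst this
  exact disjoint_left.1 hdisj hy1 hx2

theorem squeezing_bound (n : ℕ) (hn : 2 ≤ n) (Ω : Set (EuclideanSpace ℂ (Fin n)))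
    (hΩo : IsOpen Ω)
    (K : Set (EuclideanSpace ℂ (Fin n))) (hK : IsCompact K) (hKne : K.Nonempty)
    (hKΩ : K ⊆ Ω) (hD : IsConnected (Ω \ K)) {p} (hp : p ∈ K) :
    Tendsto (squeezingFn n (Ω \ K)) (𝓝[Ω \ K] p) (𝓝 0) := by
  obtain ⟨ρ, hρ, hρΩ⟩ := Metric.isOpen_iff.1 hΩo p (hKΩ hp)
  let i0 : Fin n := ⟨0, by omega⟩
  let i1 : Fin n := ⟨1, by omega⟩
  have h01 : i1 ≠ i0 := by simp [i0, i1]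
  have hnt : Nontrivial (EuclideanSpace ℂ (Fin n)) :=
    ⟨EuclideanSpace.single i0 1, 0, fun h => by
      simpa using congrArg (fun v : EuclideanSpace ℂ (Fin n) => v i0) h⟩
  refine squeeze_zero' (g := fun z => 2 / ρ * dist z p) ?_ ?_ ?_
  · refine Eventually.of_forall fun z => ?_
    exact Real.sSup_nonneg fun r hr => hr.1.le
  · filter_upwards [self_mem_nhdsWithin,
      nhdsWithin_le_nhds (ball_mem_nhds p (half_pos hρ))] with z hz hzp
    apply Real.sSup_le _ (by positivity)
    rintro r ⟨hr, F, hF, hinj, hmaps, hFz, hball⟩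
    exact key_bound (ℓ := EuclideanSpace.proj i0) (m := EuclideanSpace.proj i1)
      (e := EuclideanSpace.single i0 1) (u := EuclideanSpace.single i1 1)
      hΩo hK hKne hKΩ hD.isPreconnected (by simp) (by simp [h01]) (by simp) hp hρ hρΩ hz hzp hr
      hF hinj hmaps hFz hball
  · have h1 : Tendsto (fun z => 2 / ρ * dist z p) (𝓝 p) (𝓝 (2 / ρ * dist p p)) :=
      Continuous.tendsto (by fun_prop) p
    rw [dist_self, mul_zero] at h1
    exact h1.mono_left nhdsWithin_le_nhds

end Helpers

/-- Let `Ω ⊆ ℂⁿ`, `n ≥ 2`, be a bounded domain, `K ⊆ Ω` a nonempty compact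
set with `D = Ω ∖ K` connected.  Then `s_D(z) → 0` as `z → p` within `D`, for every
`p ∈ K ∩ ∂D`; in particular `inf_{z ∈ D} s_D(z) = 0`, i.e. `D` is not holomorphic
homogeneous regular. -/
theorem stmt12 (n : ℕ) (hn : 2 ≤ n) (Ω : Set (EuclideanSpace ℂ (Fin n)))
    (hΩo : IsOpen Ω) (hΩc : IsConnected Ω) (hΩb : Bornology.IsBounded Ω)
    (K : Set (EuclideanSpace ℂ (Fin n))) (hK : IsCompact K) (hKne : K.Nonempty)
    (hKΩ : K ⊆ Ω) (hD : IsConnected (Ω \ K)) :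
    (∀ p ∈ K ∩ frontier (Ω \ K),
      Filter.Tendsto (squeezingFn n (Ω \ K)) (nhdsWithin p (Ω \ K)) (nhds 0)) ∧
    (⨅ z : (Ω \ K : Set (EuclideanSpace ℂ (Fin n))), squeezingFn n (Ω \ K) z) = 0 := by
  refine ⟨fun p hp => squeezing_bound n hn Ω hΩo K hK hKne hKΩ hD hp.1, ?_⟩
  have hnn : ∀ z, 0 ≤ squeezingFn n (Ω \ K) z := fun z => Real.sSup_nonneg fun r hr => hr.1.le
  obtain ⟨k, hk⟩ := hKne
  obtain ⟨d, hd⟩ := hD.nonempty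
  obtain ⟨x, hx, hxc, hxD⟩ := mem_closure_of_preconnected hΩc.isPreconnected
    (hΩo.sdiff hK.isClosed) ⟨d, hd.1, hd⟩ (hKΩ hk) (fun h => h.2 hk)
  have hxK : x ∈ K := by
    by_contra h
    exact hxD ⟨hx, h⟩
  have ht := squeezing_bound n hn Ω hΩo K hK ⟨k, hk⟩ hKΩ hD hxK
  have hne : (nhdsWithin x (Ω \ K)).NeBot := mem_closure_iff_nhdsWithin_neBot.1 hxc
  apply le_antisymm
  · apply ge_of_tendsto ht
    filter_upwards [self_mem_nhdsWithin] with z hz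
    have hb : BddBelow (Set.range fun z : (Ω \ K : Set (EuclideanSpace ℂ (Fin n))) =>
        squeezingFn n (Ω \ K) z) := ⟨0, by rintro _ ⟨w, rfl⟩; exact hnn w⟩
    exact ciInf_le hb ⟨z, hz⟩
  · exact Real.iInf_nonneg fun z => hnn z
end

section
/- Let Ω ⊆ ℂⁿ, n ≥ 2, be a bounded domain and let K ⊆ Ω be a compact set such that D := Ω ∖ K is connected. Let F : D → ℂⁿ be an injective holomorphic map that is a homeomorphism onto its image F(D), and let F̃ : Ω → ℂⁿ be a holomorphic map with F̃ = F on D. Then F̃(K ∩ ∂D) ∩ F(D) = ∅. -/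
/-- Let `Ω ⊆ ℂⁿ`, `n ≥ 2`, be a bounded domain, `K ⊆ Ω` compact with
`D = Ω ∖ K` connected.  If `F` is an injective holomorphic map on `D` that is a
homeomorphism onto its image (encoded: `F` is injective, holomorphic, and maps open
subsets of `D` to open sets) and `F̃` is holomorphic on `Ω` with `F̃ = F` on `D`, then
`F̃(K ∩ ∂D) ∩ F(D) = ∅`. -/
theorem stmt13 (n : ℕ) (hn : 2 ≤ n) (Ω : Set (EuclideanSpace ℂ (Fin n)))
    (hΩo : IsOpen Ω) (hΩc : IsConnected Ω) (hΩb : Bornology.IsBounded Ω)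
    (K : Set (EuclideanSpace ℂ (Fin n))) (hK : IsCompact K) (hKΩ : K ⊆ Ω)
    (hD : IsConnected (Ω \ K))
    (F Ftilde : EuclideanSpace ℂ (Fin n) → EuclideanSpace ℂ (Fin n))
    (hFd : DifferentiableOn ℂ F (Ω \ K)) (hFi : Set.InjOn F (Ω \ K))
    (hFopen : ∀ U ⊆ Ω \ K, IsOpen U → IsOpen (F '' U))
    (hFt : DifferentiableOn ℂ Ftilde Ω) (heq : Set.EqOn Ftilde F (Ω \ K)) :
    Ftilde '' (K ∩ frontier (Ω \ K)) ∩ F '' (Ω \ K) = ∅ := by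
  rw [Set.eq_empty_iff_forall_notMem]
  rintro w ⟨⟨p, ⟨hpK, hpf⟩, hpw⟩, q, hq, hqw⟩
  have hDo : IsOpen (Ω \ K) := hΩo.sdiff hK.isClosed
  have hne : p ≠ q := by
    rintro rfl
    exact hq.2 hpK
  obtain ⟨U, V, hU, hV, hpU, hqV, hUV⟩ := t2_separation hne
  have hW : IsOpen (F '' (V ∩ (Ω \ K))) :=
    hFopen _ Set.inter_subset_right (hV.inter hDo)
  have hc : ContinuousAt Ftilde p :=
    (hFt.differentiableAt (hΩo.mem_nhds (hKΩ hpK))).continuousAt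
  have hmem : Ftilde p ∈ F '' (V ∩ (Ω \ K)) := ⟨q, ⟨hqV, hq⟩, hqw.trans hpw.symm⟩
  have h1 := hc.preimage_mem_nhds (hW.mem_nhds hmem)
  have hcl : p ∈ closure (Ω \ K) := frontier_subset_closure hpf
  obtain ⟨z, ⟨hz1, hzU⟩, hzD⟩ :=
    mem_closure_iff_nhds.1 hcl _ (Filter.inter_mem h1 (hU.mem_nhds hpU))
  obtain ⟨y, ⟨hyV, hyD⟩, hy⟩ := hz1
  have hyz : y = z := hFi hyD hzD (hy.trans (heq hzD))
  exact Set.disjoint_left.1 hUV hzU (hyz ▸ hyV)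
end

section
/- Let ε > 0 and let σ : [0, ε) → ℝ be of class C² with σ(0) = 0, σ'(0) = 0, and σ'(x) > 0 and σ''(x) > 0 for all x ∈ (0, ε). Then there exists r > 0 such that the function g(x,y,v) := −√(1 − v² − σ(x² + y²)) is well-defined (i.e., 1 − v² − σ(x² + y²) > 0) and convex on the open ball of radius r centred at the origin in ℝ³. -/
/-- Let `ε > 0` and `σ : [0,ε) → ℝ` be `C²` (encoded via first and second
derivatives `d1`, `d2`, continuous on `[0,ε)`) with `σ(0) = 0`, `σ'(0) = 0`, and
`σ' > 0`, `σ'' > 0` on `(0,ε)`.  Then there is `r > 0` such that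
`g(x,y,v) = −√(1 − v² − σ(x² + y²))` is well-defined (the radicand is positive) and
convex on the open ball of radius `r` about the origin in `ℝ³`. -/
theorem stmt17 (ε : ℝ) (hε : 0 < ε) (σ d1 d2 : ℝ → ℝ)
    (hd1 : ∀ x ∈ Set.Ico 0 ε, HasDerivWithinAt σ (d1 x) (Set.Ico 0 ε) x)
    (hd2 : ∀ x ∈ Set.Ico 0 ε, HasDerivWithinAt d1 (d2 x) (Set.Ico 0 ε) x)
    (hc1 : ContinuousOn d1 (Set.Ico 0 ε)) (hc2 : ContinuousOn d2 (Set.Ico 0 ε))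
    (h0 : σ 0 = 0) (h10 : d1 0 = 0)
    (hpos : ∀ x ∈ Set.Ioo 0 ε, 0 < d1 x ∧ 0 < d2 x) :
    ∃ r : ℝ, 0 < r ∧
      (∀ p ∈ Metric.ball (0 : EuclideanSpace ℝ (Fin 3)) r,
        0 < 1 - (p 2) ^ 2 - σ ((p 0) ^ 2 + (p 1) ^ 2)) ∧
      ConvexOn ℝ (Metric.ball (0 : EuclideanSpace ℝ (Fin 3)) r)
        (fun p => -Real.sqrt (1 - (p 2) ^ 2 - σ ((p 0) ^ 2 + (p 1) ^ 2))) := by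
  have hint : interior (Set.Ico 0 ε) = Set.Ioo 0 ε := interior_Ico
  have hcv : Convex ℝ (Set.Ico 0 ε) := convex_Ico 0 ε
  have hsc : ContinuousOn σ (Set.Ico 0 ε) := fun x hx => (hd1 x hx).continuousWithinAt
  have hD1 : ∀ x ∈ Set.Ioo 0 ε, HasDerivAt σ (d1 x) x := fun x hx =>
    (hd1 x (Set.Ioo_subset_Ico_self hx)).hasDerivAt (Ico_mem_nhds hx.1 hx.2)
  have hD2 : ∀ x ∈ Set.Ioo 0 ε, HasDerivAt d1 (d2 x) x := fun x hx =>
    (hd2 x (Set.Ioo_subset_Ico_self hx)).hasDerivAt (Ico_mem_nhds hx.1 hx.2)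
  have hmono : MonotoneOn σ (Set.Ico 0 ε) := by
    apply monotoneOn_of_deriv_nonneg hcv hsc
    · rw [hint]; exact fun x hx => (hD1 x hx).differentiableAt.differentiableWithinAt
    · rw [hint]; intro x hx; rw [(hD1 x hx).deriv]; exact (hpos x hx).1.le
  have hmono1 : MonotoneOn d1 (Set.Ico 0 ε) := by
    apply monotoneOn_of_deriv_nonneg hcv hc1
    · rw [hint]; exact fun x hx => (hD2 x hx).differentiableAt.differentiableWithinAt
    · rw [hint]; intro x hx; rw [(hD2 x hx).deriv]; exact (hpos x hx).2.le
  have hconv : ConvexOn ℝ (Set.Ico 0 ε) σ := by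
    apply MonotoneOn.convexOn_of_deriv hcv hsc
    · rw [hint]; exact fun x hx => (hD1 x hx).differentiableAt.differentiableWithinAt
    · rw [hint]; intro x hx y hy hxy
      rw [(hD1 x hx).deriv, (hD1 y hy).deriv]
      exact hmono1 (Set.Ioo_subset_Ico_self hx) (Set.Ioo_subset_Ico_self hy) hxy
  have hm0 : (0 : ℝ) ∈ Set.Ico 0 ε := ⟨le_rfl, hε⟩
  obtain ⟨δ, hδ, hδσ⟩ := Metric.continuousWithinAt_iff.1 (hsc 0 hm0) (1 / 2) (by norm_num)
  set R : ℝ := min (min ε δ) (1 / 2) with hR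
  have hRpos : 0 < R := by positivity
  have hRε : R ≤ ε := (min_le_left _ _).trans (min_le_left _ _)
  have hRδ : R ≤ δ := (min_le_left _ _).trans (min_le_right _ _)
  have hRh : R ≤ 1 / 2 := min_le_right _ _
  have hball : ∀ p ∈ Metric.ball (0 : EuclideanSpace ℝ (Fin 3)) (Real.sqrt R),
      (p 0) ^ 2 + (p 1) ^ 2 + (p 2) ^ 2 < R := by
    intro p hp
    rw [mem_ball_zero_iff, EuclideanSpace.norm_eq, Fin.sum_univ_three] at hp
    simp only [Real.norm_eq_abs, sq_abs] at hp
    exact (Real.sqrt_lt_sqrt_iff (by positivity)).1 hp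
  have hmem : ∀ p ∈ Metric.ball (0 : EuclideanSpace ℝ (Fin 3)) (Real.sqrt R),
      (p 0) ^ 2 + (p 1) ^ 2 ∈ Set.Ico 0 ε := by
    intro p hp
    have := hball p hp
    exact ⟨by positivity, by nlinarith [sq_nonneg (p 2)]⟩
  have hrad : ∀ p ∈ Metric.ball (0 : EuclideanSpace ℝ (Fin 3)) (Real.sqrt R),
      0 < 1 - (p 2) ^ 2 - σ ((p 0) ^ 2 + (p 1) ^ 2) := by
    intro p hp
    have h1 := hball p hp
    have hnn : 0 ≤ (p 0) ^ 2 + (p 1) ^ 2 := by positivity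
    have h2 := hδσ (hmem p hp) (by
      rw [Real.dist_eq, sub_zero, abs_of_nonneg hnn]
      nlinarith [sq_nonneg (p 2)])
    rw [Real.dist_eq, h0, sub_zero] at h2
    have h3 := (abs_lt.1 h2).2
    linarith
  refine ⟨Real.sqrt R, Real.sqrt_pos.2 hRpos, hrad, convex_ball _ _, ?_⟩
  intro p hp q hq a b ha hb hab
  have hpq := convex_ball (0 : EuclideanSpace ℝ (Fin 3)) (Real.sqrt R) hp hq ha hb hab
  have hsq : ∀ x y : ℝ, (a * x + b * y) ^ 2 ≤ a * x ^ 2 + b * y ^ 2 := by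
    intro x y
    have hb' : b = 1 - a := by linarith
    have := mul_nonneg (mul_nonneg ha hb) (sq_nonneg (x - y))
    subst hb'
    nlinarith
  have hm := hmem _ hpq
  have e : ∀ i, (a • p + b • q) i = a * p i + b * q i := fun i => by simp
  simp only [e, smul_eq_mul] at hm ⊢
  have hmc := hcv (hmem p hp) (hmem q hq) ha hb hab
  have hσ1 := hconv.2 (hmem p hp) (hmem q hq) ha hb hab
  simp only [smul_eq_mul] at hmc hσ1
  have hσ2 := hmono hm hmc (by linarith [hsq (p 0) (q 0), hsq (p 1) (q 1)])
  have hc := Real.strictConcaveOn_sqrt.concaveOn.2 (Set.mem_Ici.2 (hrad p hp).le)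
    (Set.mem_Ici.2 (hrad q hq).le) ha hb hab
  simp only [smul_eq_mul] at hc
  have hle := Real.sqrt_le_sqrt (show
    a * (1 - (p 2) ^ 2 - σ ((p 0) ^ 2 + (p 1) ^ 2)) + b * (1 - (q 2) ^ 2 - σ ((q 0) ^ 2 + (q 1) ^ 2))
      ≤ 1 - (a * p 2 + b * q 2) ^ 2 - σ ((a * p 0 + b * q 0) ^ 2 + (a * p 1 + b * q 1) ^ 2) by
    linarith [hsq (p 2) (q 2)])
  linarith
end
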